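/- arXiv:2009.03026 — 3 statements merged into one kernel-verified Lean document; each statement's English description precedes it below -/
import Mathlib

section
/- For any β > -2/n, the normalization constant of the Gaussian beta ensemble satisfies Z_{β,n} := ∫_{ℝⁿ} |D(λ)|^β exp(-p₂(λ)/2) dλ = (2π)^{n/2} ∏_{j=1}^n Γ(1 + jβ/2)/Γ(1 + β/2), where D(λ) = ∏_{j<j'} (λ_{j'} - λ_j) and p₂(λ) = Σ_j λ_j². -/
open MeasureTheory Real

/-- The absolute value of the Vandermonde determinant. -/
noncomputable def absVandermonde {n : ℕ} (x : Fin n → ℝ) : ℝ := |(Matrix.vandermonde x).det|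

/-- The polynomially growing weight `∏ (1 + |xᵢ|)`. -/
noncomputable def growth {n : ℕ} (x : Fin n → ℝ) : ℝ := ∏ i, (1 + |x i|)

lemma one_le_growth {n : ℕ} (x : Fin n → ℝ) : 1 ≤ growth x :=
  Finset.prod_induction _ (fun r => 1 ≤ r) (fun _ _ => one_le_mul_of_one_le_of_one_le) le_rfl
    fun i _ => by simp

lemma growth_pos {n : ℕ} (x : Fin n → ℝ) : 0 < growth x := one_pos.trans_le (one_le_growth x)

lemma growth_cons {n : ℕ} (t : ℝ) (y : Fin n → ℝ) :
    growth (Fin.cons t y : Fin (n + 1) → ℝ) = (1 + |t|) * growth y := by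
  simp [growth, Fin.prod_univ_succ]

lemma growth_le_growth_cons {n : ℕ} (t : ℝ) (y : Fin n → ℝ) :
    growth y ≤ growth (Fin.cons t y : Fin (n + 1) → ℝ) := by
  rw [growth_cons]
  exact le_mul_of_one_le_left (growth_pos y).le (by simp)

lemma absVandermonde_nonneg {n : ℕ} (x : Fin n → ℝ) : 0 ≤ absVandermonde x := abs_nonneg _

lemma absVandermonde_cons {n : ℕ} (t : ℝ) (y : Fin n → ℝ) :
    absVandermonde (Fin.cons t y : Fin (n + 1) → ℝ) = (∏ j, |t - y j|) * absVandermonde y := by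
  rw [absVandermonde, Matrix.det_vandermonde, Fin.prod_univ_succ, Fin.prod_Ioi_zero, abs_mul,
    Finset.abs_prod]
  simp [absVandermonde, Matrix.det_vandermonde, Fin.prod_Ioi_succ, abs_sub_comm t]

lemma absVandermonde_comp_perm {n : ℕ} (x : Fin n → ℝ) (σ : Equiv.Perm (Fin n)) :
    absVandermonde (x ∘ σ) = absVandermonde x := by
  have h : Matrix.vandermonde (x ∘ σ) = (Matrix.vandermonde x).submatrix σ id := by
    ext i j; simp [Matrix.vandermonde]
  rw [absVandermonde, h, Matrix.det_permute, abs_mul]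
  rcases Int.units_eq_one_or (Equiv.Perm.sign σ) with h | h <;> simp [h, absVandermonde]

lemma absVandermonde_affine {n : ℕ} (x : Fin n → ℝ) (r c : ℝ) :
    absVandermonde (fun i => r * x i + c) = (∏ j : Fin n, |r| ^ (j : ℕ)) * absVandermonde x := by
  have h : Matrix.vandermonde (fun i => r * x i)
      = Matrix.of fun i j : Fin n => r ^ (j : ℕ) * Matrix.vandermonde x i j := by
    ext i j; simp [Matrix.vandermonde, mul_pow]
  rw [absVandermonde, Matrix.det_vandermonde_add (fun i => r * x i) c, h, Matrix.det_mul_row,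
    abs_mul, Finset.abs_prod, absVandermonde]
  simp

lemma continuous_absVandermonde {n : ℕ} : Continuous (absVandermonde (n := n)) := by
  unfold absVandermonde
  simp only [Matrix.det_vandermonde]
  fun_prop

lemma abs_sub_le_growth {n : ℕ} (t : ℝ) (y : Fin n → ℝ) (j : Fin n) :
    |t - y j| ≤ growth (Fin.cons t y : Fin (n + 1) → ℝ) := by
  have h1 : 1 + |y j| ≤ growth y := by
    rw [growth, ← Finset.mul_prod_erase _ _ (Finset.mem_univ j)]
    exact le_mul_of_one_le_right (by positivity) (Finset.prod_induction _ (fun r => 1 ≤ r)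
      (fun _ _ => one_le_mul_of_one_le_of_one_le) le_rfl fun i _ => by simp)
  rw [growth_cons]
  have := abs_sub t (y j)
  nlinarith [abs_nonneg t, abs_nonneg (y j), mul_le_mul_of_nonneg_left h1 (abs_nonneg t)]

lemma prod_abs_sub_le {n : ℕ} (t : ℝ) (y : Fin n → ℝ) (s : Finset (Fin n)) :
    ∏ j ∈ s, |t - y j| ≤ growth (Fin.cons t y : Fin (n + 1) → ℝ) ^ n := by
  calc ∏ j ∈ s, |t - y j| ≤ ∏ j ∈ s, growth (Fin.cons t y : Fin (n + 1) → ℝ) :=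
        Finset.prod_le_prod (fun _ _ => abs_nonneg _) fun j _ => abs_sub_le_growth t y j
    _ = growth (Fin.cons t y : Fin (n + 1) → ℝ) ^ s.card := by simp
    _ ≤ _ := pow_le_pow_right₀ (one_le_growth _) (s.card_le_univ.trans (by simp))

lemma absVandermonde_le_growth {n : ℕ} (x : Fin n → ℝ) :
    absVandermonde x ≤ growth x ^ (n * n) := by
  induction n with
  | zero => simp [absVandermonde, growth]
  | succ n ih =>
    rw [← Fin.cons_self_tail x, absVandermonde_cons]
    set t := x 0
    set y := Fin.tail x
    have h1 := prod_abs_sub_le t y Finset.univ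
    have h2 : absVandermonde y ≤ growth (Fin.cons t y : Fin (n + 1) → ℝ) ^ (n * n) :=
      (ih y).trans (pow_le_pow_left₀ (growth_pos y).le (growth_le_growth_cons t y) _)
    calc _ ≤ growth (Fin.cons t y : Fin (n + 1) → ℝ) ^ n *
          growth (Fin.cons t y : Fin (n + 1) → ℝ) ^ (n * n) :=
          mul_le_mul h1 h2 (absVandermonde_nonneg _) (pow_nonneg (growth_pos _).le _)
      _ ≤ _ := by
          rw [← pow_add]
          exact pow_le_pow_right₀ (one_le_growth _) (by nlinarith)

lemma absVandermonde_rpow_le_growth {n : ℕ} {b : ℝ} (hb : 0 ≤ b) :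
    ∃ k : ℕ, ∀ x : Fin n → ℝ, absVandermonde x ^ b ≤ growth x ^ k := by
  refine ⟨⌈n * n * b⌉₊, fun x => ?_⟩
  calc absVandermonde x ^ b ≤ (growth x ^ (n * n)) ^ b :=
        rpow_le_rpow (absVandermonde_nonneg _) (absVandermonde_le_growth x) hb
    _ = growth x ^ (n * n * b) := by
        rw [← rpow_natCast, ← rpow_mul (growth_pos x).le]; push_cast; rfl
    _ ≤ growth x ^ (⌈n * n * b⌉₊ : ℝ) :=
        rpow_le_rpow_of_exponent_le (one_le_growth x) (Nat.le_ceil _)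
    _ = _ := rpow_natCast _ _

lemma absVandermonde_eq_zero {n : ℕ} {x : Fin n → ℝ} {i j : Fin n} (hij : i ≠ j)
    (h : x i = x j) : absVandermonde x = 0 := by
  rw [absVandermonde, abs_eq_zero]
  by_contra hdet
  exact hij (Matrix.det_vandermonde_ne_zero_iff.1 hdet h)

lemma absVandermonde_rpow_div_le_growth {n : ℕ} {b : ℝ} (hb : 1 < b) :
    ∃ k : ℕ, ∀ (x : Fin (n + 1) → ℝ) (j : Fin n),
      |absVandermonde x ^ b / (x 0 - x j.succ)| ≤ growth x ^ k := by
  obtain ⟨k, hk⟩ := absVandermonde_rpow_le_growth (n := n + 1) (b := b - 1) (by linarith)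
  refine ⟨k + (n + n * n), fun x j => ?_⟩
  rcases eq_or_ne (x 0) (x j.succ) with h | h
  · simp [h, (growth_pos x).le]
  · have hpos : 0 < |x 0 - x j.succ| := abs_pos.2 (sub_ne_zero.2 h)
    have hD : absVandermonde x ≤ |x 0 - x j.succ| * growth x ^ (n + n * n) := by
      rw [← Fin.cons_self_tail x, absVandermonde_cons]
      set t := x 0
      set y := Fin.tail x
      rw [← Finset.mul_prod_erase _ _ (Finset.mem_univ j), mul_assoc]
      simp only [Fin.cons_zero, Fin.cons_succ]
      refine mul_le_mul_of_nonneg_left ?_ (abs_nonneg _)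
      rw [pow_add]
      exact mul_le_mul (prod_abs_sub_le t y _) ((absVandermonde_le_growth y).trans
        (pow_le_pow_left₀ (growth_pos y).le (growth_le_growth_cons t y) _))
        (absVandermonde_nonneg _) (pow_nonneg (growth_pos _).le _)
    rw [abs_div, div_le_iff₀ hpos, abs_of_nonneg (rpow_nonneg (absVandermonde_nonneg x) b)]
    have h1 : absVandermonde x ^ b = absVandermonde x ^ (b - 1) * absVandermonde x := by
      rcases (absVandermonde_nonneg x).eq_or_lt with h0 | h0
      · rw [← h0, zero_rpow (by linarith), mul_zero]
      · rw [← rpow_add_one h0.ne']; ring_nf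
    rw [h1, pow_add, mul_assoc, mul_comm (_ ^ (n + n * n))]
    exact mul_le_mul (hk x) hD (absVandermonde_nonneg x) (pow_nonneg (growth_pos _).le _)

lemma hasDerivAt_absVandermonde_cons_rpow {n : ℕ} {b : ℝ} (hb : 1 < b) (y : Fin n → ℝ) (t : ℝ) :
    HasDerivAt (fun t => absVandermonde (Fin.cons t y : Fin (n + 1) → ℝ) ^ b)
      (∑ j, b * (absVandermonde (Fin.cons t y : Fin (n + 1) → ℝ) ^ b / (t - y j))) t := by
  have hprod : ∀ t, absVandermonde (Fin.cons t y : Fin (n + 1) → ℝ) ^ b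
      = (∏ j, |t - y j| ^ b) * absVandermonde y ^ b := fun t => by
    rw [absVandermonde_cons, mul_rpow (Finset.prod_nonneg fun _ _ => abs_nonneg _)
      (absVandermonde_nonneg y), finsetProd_rpow _ _ fun _ _ => abs_nonneg _]
  simp only [hprod]
  have h1 : ∀ j ∈ (Finset.univ : Finset (Fin n)),
      HasDerivAt (fun t => |t - y j| ^ b) (b * |t - y j| ^ (b - 2) * (t - y j)) t := fun j _ => by
    exact (hasDerivAt_abs_rpow (t - y j) hb).comp_sub_const t (y j)
  refine ((HasDerivAt.fun_finsetProd h1).mul_const (absVandermonde y ^ b)).congr_deriv ?_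
  rw [Finset.sum_mul]
  refine Finset.sum_congr rfl fun j _ => ?_
  rw [← Finset.mul_prod_erase _ _ (Finset.mem_univ j)]
  have h2 : |t - y j| ^ b / (t - y j) = |t - y j| ^ (b - 2) * (t - y j) := by
    rcases eq_or_ne (t - y j) 0 with h | h
    · simp [h]
    · rw [div_eq_iff h, mul_assoc, ← abs_mul_abs_self, ← mul_assoc,
        ← rpow_add_one (abs_pos.2 h).ne', ← rpow_add_one (abs_pos.2 h).ne']
      ring_nf
  rw [smul_eq_mul, mul_assoc b, ← h2]
  ring

lemma integrable_one_add_abs_pow_mul_exp (k : ℕ) :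
    Integrable fun y : ℝ => (1 + |y|) ^ k * exp (-(|y| / 2)) := by
  have h := (integrable_one_add_norm (E := ℝ) (μ := volume) (r := 2) (by simp)).const_mul
    (exp (1 / 2) * 2 ^ (k + 2) * (k + 2).factorial)
  refine h.mono' (Continuous.aestronglyMeasurable (by fun_prop)) (.of_forall fun y => ?_)
  have hy : (0 : ℝ) < 1 + |y| := by positivity
  rw [norm_of_nonneg (by positivity), norm_eq_abs, rpow_neg hy.le, ← div_eq_mul_inv,
    show (1 + |y|) ^ (2 : ℝ) = (1 + |y|) ^ 2 from rpow_two _, le_div_iff₀ (by positivity)]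
  have h1 := pow_div_factorial_le_exp ((1 + |y|) / 2) (by positivity) (k + 2)
  rw [div_pow, div_div, div_le_iff₀ (by positivity)] at h1
  have h2 : exp ((1 + |y|) / 2) * exp (-(|y| / 2)) = exp (1 / 2) := by
    rw [← exp_add]; ring_nf
  calc (1 + |y|) ^ k * exp (-(|y| / 2)) * (1 + |y|) ^ 2
      = (1 + |y|) ^ (k + 2) * exp (-(|y| / 2)) := by ring
    _ ≤ exp ((1 + |y|) / 2) * (2 ^ (k + 2) * (k + 2).factorial) * exp (-(|y| / 2)) := by gcongr
    _ = _ := by rw [← h2]; ring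

lemma integrable_growth_pow_mul_exp {n : ℕ} (k : ℕ) :
    Integrable fun x : Fin n → ℝ => growth x ^ k * exp (-((∑ i, |x i|) / 2)) := by
  have h := Integrable.fintype_prod (μ := fun _ : Fin n => (volume : Measure ℝ))
    fun _ => integrable_one_add_abs_pow_mul_exp k
  refine h.congr (.of_forall fun x => ?_)
  simp only [growth, Finset.prod_mul_distrib, Finset.prod_pow, ← exp_sum, Finset.sum_neg_distrib,
    Finset.sum_div]

/-- Lebesgue measure on the open positive orthant. -/
noncomputable def orthant (n : ℕ) : Measure (Fin n → ℝ) :=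
  Measure.pi fun _ => volume.restrict (Set.Ioi (0 : ℝ))

lemma orthant_eq_restrict (n : ℕ) :
    orthant n = volume.restrict (Set.univ.pi fun _ => Set.Ioi (0 : ℝ)) :=
  (Measure.restrict_pi_pi (fun _ : Fin n => (volume : Measure ℝ)) _).symm

lemma ae_orthant_pos (n : ℕ) : ∀ᵐ x ∂orthant n, ∀ i, 0 < x i := by
  rw [orthant_eq_restrict]
  filter_upwards [ae_restrict_mem (MeasurableSet.univ_pi fun _ => measurableSet_Ioi)] with x hx i
  exact hx i trivial

lemma integral_orthant_comp_perm {n : ℕ} (σ : Equiv.Perm (Fin n)) (f : (Fin n → ℝ) → ℝ) :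
    ∫ x, f (x ∘ σ) ∂orthant n = ∫ x, f x ∂orthant n := by
  have h := measurePreserving_piCongrLeft
    (fun _ : Fin n => volume.restrict (Set.Ioi (0 : ℝ))) σ.symm
  have h2 := h.integral_comp' f
  rw [orthant, ← h2]
  congr 1 with x
  congr 1
  ext i
  have := Equiv.piCongrLeft_apply_apply (fun _ : Fin n => ℝ) σ.symm x (σ i)
  simp only [Equiv.symm_apply_apply] at this
  exact this.symm

/-- The weight `∏ xᵢ ^ (a - 1) * exp (-xᵢ)`. -/
noncomputable def gammaWeight {n : ℕ} (a : ℝ) (x : Fin n → ℝ) : ℝ :=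
  ∏ i, x i ^ (a - 1) * exp (-x i)

lemma gammaWeight_cons {n : ℕ} (a t : ℝ) (y : Fin n → ℝ) :
    gammaWeight a (Fin.cons t y : Fin (n + 1) → ℝ) = t ^ (a - 1) * exp (-t) * gammaWeight a y := by
  simp [gammaWeight, Fin.prod_univ_succ]

lemma gammaWeight_comp_perm {n : ℕ} (a : ℝ) (x : Fin n → ℝ) (σ : Equiv.Perm (Fin n)) :
    gammaWeight a (x ∘ σ) = gammaWeight a x :=
  Equiv.prod_comp σ fun i => x i ^ (a - 1) * exp (-x i)

lemma measurable_gammaWeight {n : ℕ} (a : ℝ) : Measurable (gammaWeight (n := n) a) := by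
  unfold gammaWeight
  fun_prop

lemma gammaWeight_le {n : ℕ} {a : ℝ} (ha : 1 ≤ a) :
    ∃ k : ℕ, ∀ x : Fin n → ℝ, (∀ i, 0 < x i) →
      |gammaWeight a x| ≤ growth x ^ k * exp (-((∑ i, |x i|) / 2)) := by
  refine ⟨⌈a - 1⌉₊, fun x hx => ?_⟩
  have : growth x ^ ⌈a - 1⌉₊ * exp (-((∑ i, |x i|) / 2))
      = ∏ i, (1 + |x i|) ^ ⌈a - 1⌉₊ * exp (-(|x i| / 2)) := by
    simp only [growth, Finset.prod_mul_distrib, Finset.prod_pow, ← exp_sum, Finset.sum_neg_distrib,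
      Finset.sum_div]
  rw [this, gammaWeight, Finset.abs_prod]
  refine Finset.prod_le_prod (fun _ _ => abs_nonneg _) fun i _ => ?_
  have hi := hx i
  rw [abs_of_nonneg (by positivity), abs_of_pos hi]
  refine mul_le_mul ?_ (exp_le_exp.2 (by linarith)) (exp_pos _).le (by positivity)
  calc x i ^ (a - 1) ≤ (1 + x i) ^ (a - 1) :=
        rpow_le_rpow hi.le (by linarith) (by linarith)
    _ ≤ (1 + x i) ^ (⌈a - 1⌉₊ : ℝ) :=
        rpow_le_rpow_of_exponent_le (by linarith) (Nat.le_ceil _)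
    _ = _ := rpow_natCast _ _

lemma gammaWeight_mul_le {n : ℕ} {a : ℝ} (ha : 1 ≤ a) {g : (Fin n → ℝ) → ℝ}
    (hg : ∃ k : ℕ, ∀ x, |g x| ≤ growth x ^ k) :
    ∃ k : ℕ, ∀ x : Fin n → ℝ, (∀ i, 0 < x i) →
      |gammaWeight a x * g x| ≤ growth x ^ k * exp (-((∑ i, |x i|) / 2)) := by
  obtain ⟨k, hk⟩ := hg
  obtain ⟨l, hl⟩ := gammaWeight_le (n := n) ha
  refine ⟨l + k, fun x hx => ?_⟩
  rw [abs_mul, pow_add, mul_right_comm]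
  exact mul_le_mul (hl x hx) (hk x) (abs_nonneg _)
    (mul_nonneg (pow_nonneg (growth_pos x).le _) (exp_pos _).le)

lemma integrable_gammaWeight_mul {n : ℕ} {a : ℝ} (ha : 1 ≤ a) {g : (Fin n → ℝ) → ℝ}
    (hm : Measurable g) (hg : ∃ k : ℕ, ∀ x, |g x| ≤ growth x ^ k) :
    Integrable (fun x => gammaWeight a x * g x) (orthant n) := by
  obtain ⟨k, hk⟩ := gammaWeight_mul_le ha hg
  have h : Integrable (fun x : Fin n → ℝ => growth x ^ k * exp (-((∑ i, |x i|) / 2)))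
      (orthant n) := by
    rw [orthant_eq_restrict]
    exact (integrable_growth_pow_mul_exp k).restrict
  refine h.mono' ((measurable_gammaWeight a).mul hm).aestronglyMeasurable ?_
  filter_upwards [ae_orthant_pos n] with x hx
  exact hk x hx

/-- Fubini and the fundamental theorem of calculus in the first variable of the orthant. -/
lemma integral_orthant_deriv {n : ℕ} {h h' : (Fin (n + 1) → ℝ) → ℝ}
    (hInt : Integrable h' (orthant (n + 1)))
    (hcont : ∀ y : Fin n → ℝ, ContinuousWithinAt (fun t : ℝ => h (Fin.cons t y)) (Set.Ici 0) 0)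
    (hderiv : ∀ y : Fin n → ℝ, ∀ t : ℝ, 0 < t →
      HasDerivAt (fun t : ℝ => h (Fin.cons t y)) (h' (Fin.cons t y)) t)
    (hbound : ∃ k : ℕ, ∀ x : Fin (n + 1) → ℝ, (∀ i, 0 < x i) →
      |h x| ≤ growth x ^ k * exp (-((∑ i, |x i|) / 2))) :
    ∫ x, h' x ∂orthant (n + 1) = -∫ y, h (Fin.cons 0 y) ∂orthant n := by
  obtain ⟨k, hk⟩ := hbound
  have hmp := (measurePreserving_piFinSuccAbove
    (fun _ : Fin (n + 1) => volume.restrict (Set.Ioi (0 : ℝ))) 0).symm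
  have hsymm : ∀ p : ℝ × (Fin n → ℝ),
      (MeasurableEquiv.piFinSuccAbove (fun _ : Fin (n + 1) => ℝ) 0).symm p = Fin.cons p.1 p.2 :=
    fun p => by
      simp [MeasurableEquiv.piFinSuccAbove, Fin.insertNthEquiv]
  have hInt' := (hmp.integrable_comp_emb (MeasurableEquiv.measurableEmbedding _)).2 hInt
  have hI := hmp.integral_comp' h'
  simp only [hsymm, Function.comp_def] at hInt' hI
  change _ = ∫ x, h' x ∂orthant (n + 1) at hI
  rw [← hI, integral_prod_symm _ hInt', ← integral_neg]
  refine integral_congr_ae ?_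
  filter_upwards [hInt'.prod_left_ae, ae_orthant_pos n] with y hy hpos
  have htop : Filter.Tendsto (fun t : ℝ => h (Fin.cons t y)) Filter.atTop (nhds 0) := by
    have h1 : Filter.Tendsto (fun t : ℝ => growth y ^ k * exp (-((∑ i, |y i|) / 2)) *
        ((1 + t) ^ k * exp (-(t / 2)))) Filter.atTop (nhds 0) := by
      rw [← mul_zero (growth y ^ k * exp (-((∑ i, |y i|) / 2)))]
      refine Filter.Tendsto.const_mul _ ?_
      have h2 := (tendsto_rpow_mul_exp_neg_mul_atTop_nhds_zero k (1 / 2) (by norm_num)).comp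
        (Filter.tendsto_atTop_add_const_left Filter.atTop 1 Filter.tendsto_id)
      have h3 := h2.mul_const (exp (1 / 2))
      rw [zero_mul] at h3
      refine h3.congr fun t => ?_
      simp only [Function.comp_apply, rpow_natCast, id]
      rw [mul_assoc, ← exp_add]
      ring_nf
    refine squeeze_zero_norm' ?_ h1
    filter_upwards [Filter.eventually_gt_atTop 0] with t ht
    refine (hk (Fin.cons t y) fun i => ?_).trans_eq ?_
    · refine Fin.cases ?_ ?_ i <;> simp [ht, hpos]
    · rw [growth_cons, Fin.sum_univ_succ, abs_of_pos (show 0 < (Fin.cons t y : Fin (n+1) → ℝ) 0 from ht)]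
      simp only [Fin.cons_zero, Fin.cons_succ, abs_of_pos ht, add_div, neg_add, exp_add, mul_pow]
      ring
  rw [integral_Ioi_of_hasDerivAt_of_tendsto (hcont y) (fun t ht => hderiv y t ht) hy htop]
  simp

/-- The moment `∫ ∏_{i ∈ A} xᵢ` of the Laguerre ensemble. -/
noncomputable def laguerreMoment {n : ℕ} (a b : ℝ) (A : Finset (Fin n)) : ℝ :=
  ∫ x, gammaWeight a x * ((∏ i ∈ A, x i) * absVandermonde x ^ b) ∂orthant n

lemma abs_prod_le_growth {n : ℕ} (A : Finset (Fin n)) (x : Fin n → ℝ) :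
    |∏ i ∈ A, x i| ≤ growth x := by
  rw [Finset.abs_prod, growth, ← Finset.prod_mul_prod_compl A fun i => 1 + |x i|]
  refine (Finset.prod_le_prod (fun _ _ => abs_nonneg _) fun i _ => ?_).trans
    (le_mul_of_one_le_right (Finset.prod_nonneg fun _ _ => by positivity)
      (Finset.prod_induction _ (fun r => 1 ≤ r)
        (fun _ _ => one_le_mul_of_one_le_of_one_le) le_rfl fun i _ => by simp))
  linarith

lemma prod_mul_rpow_le_growth {n : ℕ} {b : ℝ} (hb : 1 < b) (A : Finset (Fin n)) :
    ∃ k : ℕ, ∀ x : Fin n → ℝ, |(∏ i ∈ A, x i) * absVandermonde x ^ b| ≤ growth x ^ k := by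
  obtain ⟨k, hk⟩ := absVandermonde_rpow_le_growth (n := n) (b := b) (by linarith)
  refine ⟨1 + k, fun x => ?_⟩
  rw [abs_mul, pow_add, pow_one, abs_of_nonneg (rpow_nonneg (absVandermonde_nonneg x) b)]
  exact mul_le_mul (abs_prod_le_growth A x) (hk x) (rpow_nonneg (absVandermonde_nonneg x) b)
    (growth_pos x).le

lemma prod_mul_rpow_div_le_growth {n : ℕ} {b : ℝ} (hb : 1 < b) (A : Finset (Fin (n + 1)))
    (j : Fin n) :
    ∃ k : ℕ, ∀ x : Fin (n + 1) → ℝ,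
      |(∏ i ∈ A, x i) * (absVandermonde x ^ b / (x 0 - x j.succ))| ≤ growth x ^ k := by
  obtain ⟨k, hk⟩ := absVandermonde_rpow_div_le_growth (n := n) hb
  refine ⟨1 + k, fun x => ?_⟩
  rw [abs_mul, pow_add, pow_one]
  exact mul_le_mul (abs_prod_le_growth A x) (hk x j) (abs_nonneg _) (growth_pos x).le

lemma measurable_absVandermonde {n : ℕ} : Measurable (absVandermonde (n := n)) :=
  continuous_absVandermonde.measurable

lemma integrable_laguerreMoment {n : ℕ} {a b : ℝ} (ha : 1 ≤ a) (hb : 1 < b) (A : Finset (Fin n)) :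
    Integrable (fun x => gammaWeight a x * ((∏ i ∈ A, x i) * absVandermonde x ^ b))
      (orthant n) := by
  refine integrable_gammaWeight_mul ha ?_ (prod_mul_rpow_le_growth hb A)
  have := measurable_absVandermonde (n := n)
  fun_prop

lemma integrable_laguerreMoment_div {n : ℕ} {a b : ℝ} (ha : 1 ≤ a) (hb : 1 < b)
    (A : Finset (Fin (n + 1))) (j : Fin n) :
    Integrable (fun x => gammaWeight a x *
      ((∏ i ∈ A, x i) * (absVandermonde x ^ b / (x 0 - x j.succ)))) (orthant (n + 1)) := by
  refine integrable_gammaWeight_mul ha ?_ (prod_mul_rpow_div_le_growth hb A j)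
  have := measurable_absVandermonde (n := n + 1)
  fun_prop

lemma laguerreMoment_map_perm {n : ℕ} (a b : ℝ) (A : Finset (Fin n)) (σ : Equiv.Perm (Fin n)) :
    laguerreMoment a b (A.map σ.toEmbedding) = laguerreMoment a b A := by
  rw [laguerreMoment, laguerreMoment, ← integral_orthant_comp_perm σ
    fun x => gammaWeight a x * ((∏ i ∈ A, x i) * absVandermonde x ^ b)]
  simp only [gammaWeight_comp_perm, absVandermonde_comp_perm, Finset.prod_map,
    Equiv.coe_toEmbedding, Function.comp_apply]

lemma prod_comp_swap {n : ℕ} (A : Finset (Fin n)) {i j : Fin n} (h : i ∈ A ↔ j ∈ A)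
    (x : Fin n → ℝ) : ∏ l ∈ A, x (Equiv.swap i j l) = ∏ l ∈ A, x l := by
  refine Finset.prod_equiv (Equiv.swap i j) (fun l => ?_) fun _ _ => rfl
  rcases eq_or_ne l i with rfl | hi
  · simpa using h
  rcases eq_or_ne l j with rfl | hj
  · simpa using h.symm
  rw [Equiv.swap_apply_of_ne_of_ne hi hj]

lemma integral_div_eq_zero {n : ℕ} (a b : ℝ) (A : Finset (Fin (n + 1))) (j : Fin n)
    (h : 0 ∈ A ↔ j.succ ∈ A) :
    ∫ x, gammaWeight a x * ((∏ i ∈ A, x i) * (absVandermonde x ^ b / (x 0 - x j.succ)))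
      ∂orthant (n + 1) = 0 := by
  rw [← self_eq_neg, ← integral_neg]
  conv_lhs => rw [← integral_orthant_comp_perm (Equiv.swap 0 j.succ)]
  congr 1 with x
  simp only [gammaWeight_comp_perm, absVandermonde_comp_perm, Function.comp_apply,
    prod_comp_swap A h, Equiv.swap_apply_left, Equiv.swap_apply_right]
  rw [← neg_sub (x 0), div_neg]
  ring

lemma integral_div_eq_half {n : ℕ} {a b : ℝ} (ha : 1 ≤ a) (hb : 1 < b) (A : Finset (Fin (n + 1)))
    (j : Fin n) (h0 : 0 ∈ A) (hj : j.succ ∉ A) :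
    ∫ x, gammaWeight a x * ((∏ i ∈ A, x i) * (absVandermonde x ^ b / (x 0 - x j.succ)))
      ∂orthant (n + 1) = laguerreMoment a b (A.erase 0) / 2 := by
  set B := A.erase 0 with hB
  have hprod : ∀ x : Fin (n + 1) → ℝ, ∏ i ∈ A, x i = x 0 * ∏ i ∈ B, x i :=
    fun x => (Finset.mul_prod_erase A x h0).symm
  have hsw : 0 ∈ B ↔ j.succ ∈ B := by simp [hB, hj]
  rw [eq_div_iff two_ne_zero, mul_two]
  nth_rewrite 2 [← integral_orthant_comp_perm (Equiv.swap 0 j.succ)]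
  have hi := integrable_laguerreMoment_div ha hb A j
  have hi2 := (integrable_laguerreMoment_div ha hb (insert j.succ B) j).neg
  have hprod2 : ∀ x : Fin (n + 1) → ℝ,
      ∏ i ∈ insert j.succ B, x i = x j.succ * ∏ i ∈ B, x i :=
    fun x => Finset.prod_insert (by simp [hB, hj])
  have heq : ∀ x : Fin (n + 1) → ℝ, gammaWeight a (x ∘ Equiv.swap 0 j.succ) *
      ((∏ i ∈ A, (x ∘ Equiv.swap 0 j.succ) i) *
        (absVandermonde (x ∘ Equiv.swap 0 j.succ) ^ b /
          ((x ∘ Equiv.swap 0 j.succ) 0 - (x ∘ Equiv.swap 0 j.succ) j.succ)))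
      = -(gammaWeight a x * ((∏ i ∈ insert j.succ B, x i) *
        (absVandermonde x ^ b / (x 0 - x j.succ)))) := fun x => by
    simp only [gammaWeight_comp_perm, absVandermonde_comp_perm, hprod, hprod2, Function.comp_apply,
      prod_comp_swap B hsw, Equiv.swap_apply_left, Equiv.swap_apply_right]
    rw [← neg_sub (x 0), div_neg]
    ring
  simp only [heq]
  refine (integral_add hi hi2).symm.trans ?_
  rw [laguerreMoment]
  congr 1 with x
  simp only [Pi.neg_apply, hprod, hprod2]
  rcases eq_or_ne (x 0) (x j.succ) with h | h
  · rw [absVandermonde_eq_zero (Fin.succ_ne_zero j).symm h, zero_rpow (by linarith)]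
    simp
  · have := sub_ne_zero.2 h
    field_simp
    ring

lemma prod_cons_mem {n : ℕ} (A : Finset (Fin (n + 1))) (h0 : 0 ∈ A) (t : ℝ) (y : Fin n → ℝ) :
    ∏ i ∈ A, (Fin.cons t y : Fin (n + 1) → ℝ) i = t * ∏ j, if j.succ ∈ A then y j else 1 := by
  rw [← Finset.prod_ite_mem_eq A, Fin.prod_univ_succ]
  simp [h0]

lemma prod_cons_erase {n : ℕ} (A : Finset (Fin (n + 1))) (t : ℝ) (y : Fin n → ℝ) :
    ∏ i ∈ A.erase 0, (Fin.cons t y : Fin (n + 1) → ℝ) i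
      = ∏ j, if j.succ ∈ A then y j else 1 := by
  rw [← Finset.prod_ite_mem_eq (A.erase 0), Fin.prod_univ_succ]
  simp [Fin.succ_ne_zero]

lemma continuous_absVandermonde_cons_rpow {n : ℕ} {b : ℝ} (hb : 1 < b) (y : Fin n → ℝ) :
    Continuous fun t : ℝ => absVandermonde (Fin.cons t y : Fin (n + 1) → ℝ) ^ b :=
  continuous_iff_continuousAt.2 fun t => (hasDerivAt_absVandermonde_cons_rpow hb y t).continuousAt

/-- The Aomoto recursion, removing the first variable. -/
lemma laguerreMoment_erase_zero {n : ℕ} {a b : ℝ} (ha : 1 ≤ a) (hb : 1 < b)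
    (A : Finset (Fin (n + 1))) (h0 : 0 ∈ A) :
    laguerreMoment a b A
      = (a + b / 2 * ((n + 1 : ℕ) - A.card)) * laguerreMoment a b (A.erase 0) := by
  set h : (Fin (n + 1) → ℝ) → ℝ := fun x =>
    gammaWeight a x * ((∏ i ∈ A, x i) * absVandermonde x ^ b) with hdef
  set d : Fin n → (Fin (n + 1) → ℝ) → ℝ := fun j x =>
    gammaWeight a x * ((∏ i ∈ A, x i) * (absVandermonde x ^ b / (x 0 - x j.succ))) with hd
  set e : (Fin (n + 1) → ℝ) → ℝ := fun x =>
    gammaWeight a x * ((∏ i ∈ A.erase 0, x i) * absVandermonde x ^ b) with he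
  have hih : Integrable h (orthant (n + 1)) := integrable_laguerreMoment ha hb A
  have hie : Integrable e (orthant (n + 1)) := integrable_laguerreMoment ha hb (A.erase 0)
  have hid : ∀ j, Integrable (d j) (orthant (n + 1)) := integrable_laguerreMoment_div ha hb A
  have hint1 : Integrable (fun x => a * e x - h x) (orthant (n + 1)) := (hie.const_mul a).sub hih
  have hint2 : Integrable (fun x => ∑ j, b * d j x) (orthant (n + 1)) :=
    integrable_finsetSum _ fun j _ => (hid j).const_mul b
  have key := integral_orthant_deriv (h := h) (h' := fun x => (a * e x - h x) + ∑ j, b * d j x)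
    (hint1.add hint2) (fun y => ?_) (fun y t ht => ?_)
    (gammaWeight_mul_le ha (prod_mul_rpow_le_growth hb A))
  · have hz : ∀ y : Fin n → ℝ, h (Fin.cons 0 y) = 0 := fun y => by
      simp [hdef, prod_cons_mem A h0]
    simp only [hz, integral_zero, neg_zero] at key
    rw [integral_add hint1 hint2, integral_sub (hie.const_mul a) hih, integral_const_mul,
      integral_finsetSum _ fun j _ => (hid j).const_mul b] at key
    simp only [integral_const_mul] at key
    have hdj : ∀ j, ∫ x, d j x ∂orthant (n + 1)
        = if j.succ ∈ A then 0 else laguerreMoment a b (A.erase 0) / 2 := fun j => by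
      split_ifs with hj
      · exact integral_div_eq_zero a b A j (by simp [h0, hj])
      · exact integral_div_eq_half ha hb A j h0 hj
    have hcount : ∑ j : Fin n, (if j.succ ∈ A then (0 : ℝ) else 1) = (n + 1 : ℕ) - A.card := by
      have h1 : ∑ i : Fin (n + 1), (if i ∈ A then (1 : ℝ) else 0) = A.card := by simp
      rw [Fin.sum_univ_succ, if_pos h0] at h1
      have h2 : ∀ j : Fin n, (if j.succ ∈ A then (0 : ℝ) else 1)
          = 1 - if j.succ ∈ A then (1 : ℝ) else 0 := fun j => by split_ifs <;> simp
      simp only [h2, Finset.sum_sub_distrib, ← h1]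
      simp
      ring
    have hsum : ∑ j, b * ∫ x, d j x ∂orthant (n + 1)
        = b / 2 * ((n + 1 : ℕ) - A.card) * laguerreMoment a b (A.erase 0) := by
      rw [← hcount, Finset.mul_sum, Finset.sum_mul]
      refine Finset.sum_congr rfl fun j _ => ?_
      rw [hdj]
      split_ifs <;> ring
    rw [hsum] at key
    change a * laguerreMoment a b (A.erase 0) - laguerreMoment a b A + _ = 0 at key
    linarith
  · refine Continuous.continuousWithinAt ?_
    simp only [hdef, gammaWeight_cons, prod_cons_mem A h0]
    have h1 := continuous_absVandermonde_cons_rpow hb y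
    have h2 : Continuous fun t : ℝ => t ^ (a - 1) := continuous_rpow_const (by linarith)
    fun_prop
  · set c := gammaWeight a y * ∏ j, if j.succ ∈ A then y j else 1 with hc
    have h1 : HasDerivAt (fun t : ℝ => t ^ (a - 1)) ((a - 1) * t ^ (a - 1 - 1)) t :=
      hasDerivAt_rpow_const (Or.inl ht.ne')
    have h2 : HasDerivAt (fun t : ℝ => exp (-t)) (-exp (-t)) t := by
      simpa using (hasDerivAt_neg t).exp
    have h3 := hasDerivAt_absVandermonde_cons_rpow hb y t
    have h4 := ((((h1.fun_mul (hasDerivAt_id' t)).fun_mul h2).fun_mul h3).const_mul c)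
    have h5 : t ^ (a - 1) = t ^ (a - 1 - 1) * t := by
      rw [← rpow_add_one ht.ne']; ring_nf
    have h6 : (fun t : ℝ => h (Fin.cons t y)) = fun t => c * (t ^ (a - 1) * t * exp (-t) *
        absVandermonde (Fin.cons t y : Fin (n + 1) → ℝ) ^ b) := by
      ext t
      simp only [hdef, gammaWeight_cons, prod_cons_mem A h0, hc]
      ring
    rw [h6]
    refine h4.congr_deriv (Eq.symm ?_)
    · simp only [hdef, hd, he, gammaWeight_cons, prod_cons_mem A h0, prod_cons_erase, hc,
        Fin.cons_zero, Fin.cons_succ, h5, Finset.mul_sum, mul_add]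
      congr 1
      · ring
      · refine Finset.sum_congr rfl fun j _ => ?_
        ring

lemma laguerreMoment_erase {n : ℕ} {a b : ℝ} (ha : 1 ≤ a) (hb : 1 < b)
    (A : Finset (Fin n)) {i : Fin n} (hi : i ∈ A) :
    laguerreMoment a b A = (a + b / 2 * (n - A.card)) * laguerreMoment a b (A.erase i) := by
  obtain _ | n := n
  · exact i.elim0
  set τ := (Equiv.swap 0 i).toEmbedding
  have h0 : (0 : Fin (n + 1)) ∈ A.map τ :=
    Finset.mem_map.2 ⟨i, hi, Equiv.swap_apply_right 0 i⟩
  have h1 : (A.map τ).erase 0 = (A.erase i).map τ := by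
    rw [Finset.map_erase]; congr 1; exact (Equiv.swap_apply_right 0 i).symm
  rw [← laguerreMoment_map_perm a b A (Equiv.swap 0 i), laguerreMoment_erase_zero ha hb _ h0, h1,
    laguerreMoment_map_perm, Finset.card_map]

lemma laguerreMoment_eq {n : ℕ} {a b : ℝ} (ha : 1 ≤ a) (hb : 1 < b) (A : Finset (Fin n)) :
    laguerreMoment a b A
      = (∏ j ∈ Finset.range A.card, (a + b / 2 * (n - (j + 1)))) *
        laguerreMoment a b (∅ : Finset (Fin n)) := by
  induction A using Finset.induction_on with
  | empty => simp
  | insert i s hi ih =>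
    rw [laguerreMoment_erase ha hb _ (Finset.mem_insert_self i s), Finset.erase_insert hi, ih,
      Finset.card_insert_of_notMem hi, Finset.prod_range_succ]
    push_cast
    ring

/-- The normalization constant of the Laguerre ensemble. -/
noncomputable def laguerreZ (n : ℕ) (a b : ℝ) : ℝ :=
  ∫ x : Fin n → ℝ, gammaWeight a x * absVandermonde x ^ b ∂orthant n

lemma laguerreZ_add_one (n : ℕ) {a b : ℝ} (ha : 1 ≤ a) (hb : 1 < b) :
    laguerreZ n (a + 1) b = (∏ j ∈ Finset.range n, (a + j * (b / 2))) * laguerreZ n a b := by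
  have h1 : laguerreZ n (a + 1) b = laguerreMoment (n := n) a b Finset.univ := by
    refine integral_congr_ae ?_
    filter_upwards [ae_orthant_pos n] with x hx
    simp only [gammaWeight, ← mul_assoc, ← Finset.prod_mul_distrib]
    congr 2 with i
    rw [add_sub_right_comm, rpow_add_one (hx i).ne']
    ring
  have h2 : laguerreZ n a b = laguerreMoment (n := n) a b ∅ := by simp [laguerreZ, laguerreMoment]
  rw [h1, laguerreMoment_eq ha hb, h2, Finset.card_univ, Fintype.card_fin,
    ← Finset.prod_range_reflect]
  congr 1
  refine Finset.prod_congr rfl fun j hj => ?_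
  have := Finset.mem_range.1 hj
  rw [show n - 1 - j = n - (j + 1) by omega, Nat.cast_sub (by omega)]
  push_cast
  ring

/-- Splitting off the boundary contribution at the origin. -/
lemma laguerreZ_succ_one (n : ℕ) {b : ℝ} (hb : 1 < b) :
    laguerreZ (n + 1) 1 b = laguerreZ n (1 + b) b := by
  set h : (Fin (n + 1) → ℝ) → ℝ := fun x =>
    gammaWeight 1 x * ((∏ i ∈ (∅ : Finset (Fin (n + 1))), x i) * absVandermonde x ^ b) with hdef
  set d : Fin n → (Fin (n + 1) → ℝ) → ℝ := fun j x =>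
    gammaWeight 1 x * ((∏ i ∈ (∅ : Finset (Fin (n + 1))), x i) *
      (absVandermonde x ^ b / (x 0 - x j.succ))) with hd
  have hih : Integrable h (orthant (n + 1)) := integrable_laguerreMoment le_rfl hb ∅
  have hid : ∀ j, Integrable (d j) (orthant (n + 1)) := integrable_laguerreMoment_div le_rfl hb ∅
  have hint2 : Integrable (fun x => ∑ j, b * d j x) (orthant (n + 1)) :=
    integrable_finsetSum _ fun j _ => (hid j).const_mul b
  have key := integral_orthant_deriv (h := h) (h' := fun x => -h x + ∑ j, b * d j x)
    (hih.neg.add hint2) (fun y => ?_) (fun y t ht => ?_)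
    (gammaWeight_mul_le le_rfl (prod_mul_rpow_le_growth hb ∅))
  · rw [show ∫ x, (-h x + ∑ j, b * d j x) ∂orthant (n + 1) = _ from integral_add hih.neg hint2,
      integral_neg,
      integral_finsetSum _ fun j _ => (hid j).const_mul b] at key
    simp only [integral_const_mul] at key
    have hdj : ∀ j, ∫ x, d j x ∂orthant (n + 1) = 0 := fun j =>
      integral_div_eq_zero 1 b ∅ j (by simp)
    simp only [hdj, mul_zero, Finset.sum_const_zero, add_zero, neg_inj] at key
    have h1 : laguerreZ (n + 1) 1 b = ∫ x, h x ∂orthant (n + 1) := by simp [laguerreZ, hdef]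
    rw [h1, key]
    refine integral_congr_ae ?_
    filter_upwards [ae_orthant_pos n] with y hy
    simp only [hdef, gammaWeight_cons, absVandermonde_cons, Finset.prod_empty]
    rw [mul_rpow (Finset.prod_nonneg fun _ _ => abs_nonneg _) (absVandermonde_nonneg y),
      ← finsetProd_rpow _ _ fun _ _ => abs_nonneg _]
    simp only [gammaWeight, Finset.prod_mul_distrib]
    simp [abs_of_pos (hy _)]
    ring
  · refine Continuous.continuousWithinAt ?_
    simp only [hdef, gammaWeight_cons, Finset.prod_empty, sub_self, rpow_zero]
    have h1 := continuous_absVandermonde_cons_rpow hb y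
    fun_prop
  · have h2 : HasDerivAt (fun t : ℝ => exp (-t)) (-exp (-t)) t := by
      simpa using (hasDerivAt_neg t).exp
    have h3 := hasDerivAt_absVandermonde_cons_rpow hb y t
    have h6 : (fun t : ℝ => h (Fin.cons t y)) = fun t => gammaWeight 1 y * (exp (-t) *
        absVandermonde (Fin.cons t y : Fin (n + 1) → ℝ) ^ b) := by
      ext t
      simp only [hdef, gammaWeight_cons, Finset.prod_empty, sub_self, rpow_zero]
      ring
    rw [h6]
    refine ((h2.fun_mul h3).const_mul (gammaWeight 1 y)).congr_deriv (Eq.symm ?_)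
    · simp only [hdef, hd, gammaWeight_cons, Finset.prod_empty, sub_self, rpow_zero,
        Fin.cons_zero, Fin.cons_succ, Finset.mul_sum, mul_add]
      congr 1
      · ring
      · refine Finset.sum_congr rfl fun j _ => ?_
        ring

/-- The Gaussian beta ensemble integral. -/
noncomputable def gaussZ (n : ℕ) (b : ℝ) : ℝ :=
  ∫ x : Fin n → ℝ, (∏ i, exp (-(x i ^ 2 / 2))) * absVandermonde x ^ b

/-- The density `x ^ (m + s) * exp (-x)`, recentred at `m = u ^ 2` and rescaled by `u`. -/
noncomputable def gammaProfile (u s y : ℝ) : ℝ :=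
  if 0 < 1 + y / u then (1 + y / u) ^ s * exp (u ^ 2 * (log (1 + y / u) - y / u)) else 0

/-- The scale of `Γ (1 + v + m)`. -/
noncomputable def stirlingScale (m : ℕ) (v : ℝ) : ℝ :=
  √m * ((m : ℝ) ^ v * ((m : ℝ) ^ m * exp (-m)))

lemma stirlingScale_pos {m : ℕ} (hm : 0 < m) (v : ℝ) : 0 < stirlingScale m v := by
  unfold stirlingScale
  positivity

lemma measurable_gammaProfile (u s : ℝ) : Measurable (gammaProfile u s) := by
  unfold gammaProfile
  refine Measurable.ite (measurableSet_lt measurable_const (by fun_prop)) ?_ measurable_const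
  fun_prop

lemma log_one_add_sub_le {t : ℝ} (ht : 0 < 1 + t) : log (1 + t) - t ≤ -(t ^ 2 / (2 * (2 + t))) := by
  set r := √(1 + t) with hr
  have hr0 : 0 < r := sqrt_pos.2 ht
  have hr2 : 1 + t = r ^ 2 := (sq_sqrt ht.le).symm
  have hlog : log (1 + t) ≤ 2 * (r - 1) := by
    rw [hr2, log_pow]
    push_cast
    linarith [log_le_sub_one_of_pos hr0]
  have ht' : t = r ^ 2 - 1 := by linarith
  have h1 : t ^ 2 / (2 * (2 + t)) ≤ (r - 1) ^ 2 := by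
    rw [div_le_iff₀ (by linarith), ht']
    nlinarith [mul_nonneg (sq_nonneg (r - 1)) (sq_nonneg (r - 1))]
  nlinarith

lemma gammaProfile_nonneg (u s y : ℝ) : 0 ≤ gammaProfile u s y := by
  unfold gammaProfile
  split_ifs
  · positivity
  · rfl

lemma gammaProfile_le {u s : ℝ} (hu : 1 ≤ u) (hs : 0 ≤ s) (y : ℝ) :
    gammaProfile u s y ≤ exp 1 * ((1 + |y|) ^ ⌈s⌉₊ * exp (-(|y| / 2))) := by
  unfold gammaProfile
  split_ifs with h
  · have hyu : y / u ≤ |y| := (le_abs_self _).trans (by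
      rw [abs_div, abs_of_pos (by linarith : 0 < u)]
      exact div_le_self (abs_nonneg y) hu)
    have h1 : (1 + y / u) ^ s ≤ (1 + |y|) ^ ⌈s⌉₊ := by
      calc (1 + y / u) ^ s ≤ (1 + |y|) ^ s := rpow_le_rpow h.le (by linarith) hs
        _ ≤ (1 + |y|) ^ (⌈s⌉₊ : ℝ) :=
          rpow_le_rpow_of_exponent_le (by simp) (Nat.le_ceil _)
        _ = _ := rpow_natCast _ _
    have h2 : u ^ 2 * (log (1 + y / u) - y / u) ≤ 1 + -(|y| / 2) := by
      have h3 := mul_le_mul_of_nonneg_left (log_one_add_sub_le h) (sq_nonneg u)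
      refine h3.trans ?_
      have h4 : u ^ 2 * -((y / u) ^ 2 / (2 * (2 + y / u))) = -(y ^ 2 / (2 * (2 + y / u))) := by
        have : u ≠ 0 := by linarith
        rw [div_pow]
        field_simp
      have h5 : y ^ 2 / (2 * (2 + |y|)) ≤ y ^ 2 / (2 * (2 + y / u)) :=
        div_le_div_of_nonneg_left (sq_nonneg y) (by linarith) (by linarith)
      have h6 : (|y| - 2) / 2 ≤ y ^ 2 / (2 * (2 + |y|)) := by
        rw [le_div_iff₀ (by positivity), ← sq_abs y]
        nlinarith
      rw [h4]
      linarith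
    calc (1 + y / u) ^ s * exp (u ^ 2 * (log (1 + y / u) - y / u))
        ≤ (1 + |y|) ^ ⌈s⌉₊ * exp (1 + -(|y| / 2)) :=
          mul_le_mul h1 (exp_le_exp.2 h2) (exp_pos _).le (by positivity)
      _ = _ := by rw [exp_add]; ring
  · positivity

lemma tendsto_gammaProfile (s y : ℝ) :
    Filter.Tendsto (fun u => gammaProfile u s y) Filter.atTop (nhds (exp (-(y ^ 2 / 2)))) := by
  have hdiv : Filter.Tendsto (fun u : ℝ => 1 + y / u) Filter.atTop (nhds 1) := by
    simpa using (Filter.Tendsto.const_div_atTop Filter.tendsto_id y).const_add (1 : ℝ)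
  have hpow : Filter.Tendsto (fun u : ℝ => (1 + y / u) ^ s) Filter.atTop (nhds 1) := by
    simpa using hdiv.rpow_const (p := s) (Or.inl one_ne_zero)
  have hlog : Filter.Tendsto (fun u : ℝ => u ^ 2 * (log (1 + y / u) - y / u)) Filter.atTop
      (nhds (-(y ^ 2 / 2))) := by
    rw [tendsto_iff_norm_sub_tendsto_zero]
    have h0 : Filter.Tendsto (fun u : ℝ => |y| ^ 3 / (u - |y|)) Filter.atTop (nhds 0) :=
      Filter.Tendsto.const_div_atTop
        (Filter.tendsto_atTop_add_const_right _ (-|y|) Filter.tendsto_id) _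
    refine squeeze_zero' (.of_forall fun _ => norm_nonneg _) ?_ h0
    filter_upwards [Filter.eventually_gt_atTop |y|] with u hu
    have hu0 : 0 < u := (abs_nonneg y).trans_lt hu
    have habs : |-(y / u)| = |y| / u := by rw [abs_neg, abs_div, abs_of_pos hu0]
    have h1 := abs_log_sub_add_sum_range_le (x := -(y / u))
      (by rw [habs, div_lt_one hu0]; exact hu) 2
    rw [habs] at h1
    have h2 : u ^ 2 * (log (1 + y / u) - y / u) - -(y ^ 2 / 2)
        = u ^ 2 * (∑ i ∈ Finset.range 2, (-(y / u)) ^ (i + 1) / ((i : ℝ) + 1)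
          + log (1 - -(y / u))) := by
      simp only [Finset.sum_range_succ, Finset.sum_range_zero, sub_neg_eq_add]
      norm_num
      field_simp
      ring
    rw [h2, norm_mul, norm_eq_abs, norm_eq_abs, abs_of_nonneg (sq_nonneg u)]
    refine (mul_le_mul_of_nonneg_left h1 (sq_nonneg u)).trans_eq ?_
    have : u - |y| ≠ 0 := by linarith
    have h3 : 1 - |y| / u ≠ 0 := by
      rw [one_sub_div hu0.ne']; positivity
    rw [one_sub_div hu0.ne', div_pow]
    field_simp
  have h := hpow.mul ((continuous_exp.tendsto _).comp hlog)
  rw [one_mul] at h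
  refine h.congr' ?_
  filter_upwards [hdiv.eventually (lt_mem_nhds (zero_lt_one' ℝ))] with u hu
  simp [gammaProfile, hu]

lemma indicator_eq_gammaProfile {m : ℕ} (hm : 0 < m) (s y : ℝ) :
    (Set.Ioi (0 : ℝ)).indicator (fun x => x ^ (s + m) * exp (-x)) (√m * y + m)
      = (m : ℝ) ^ s * ((m : ℝ) ^ m * exp (-m)) * gammaProfile √m s y := by
  have hm0 : (0 : ℝ) < m := Nat.cast_pos.2 hm
  have hr : 0 < √(m : ℝ) := sqrt_pos.2 hm0
  have hsq : √(m : ℝ) ^ 2 = m := sq_sqrt hm0.le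
  have hx : √m * y + m = m * (1 + y / √m) := by
    have : (m : ℝ) * (y / √m) = √m * y := by
      rw [← mul_div_assoc, div_eq_iff hr.ne']
      linear_combination (-y) * hsq
    rw [mul_add, this]
    ring
  by_cases h : 0 < 1 + y / √(m : ℝ)
  · have hmem : √m * y + m ∈ Set.Ioi (0 : ℝ) := by
      rw [hx]; exact mul_pos hm0 h
    rw [Set.indicator_of_mem hmem, gammaProfile, if_pos h, hx, mul_rpow hm0.le h.le, hsq,
      rpow_add hm0, rpow_add h, rpow_natCast, rpow_natCast]
    have h1 : exp (m * (log (1 + y / √m) - y / √m))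
        = (1 + y / √m) ^ m * exp (-(m * (y / √m))) := by
      rw [mul_sub, sub_eq_add_neg, exp_add, ← log_pow, exp_log (pow_pos h m)]
    rw [h1, mul_add, neg_add, exp_add, mul_one]
    ring
  · have hmem : √m * y + m ∉ Set.Ioi (0 : ℝ) := by
      rw [hx, Set.mem_Ioi]; exact fun h' => h (pos_of_mul_pos_right h' hm0.le)
    rw [Set.indicator_of_notMem hmem, gammaProfile, if_neg h, mul_zero]

lemma laguerreZ_eq_scaled (n : ℕ) {m : ℕ} (hm : 0 < m) (s b : ℝ) :
    laguerreZ n (1 + s + m) b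
      = (∏ j ∈ Finset.range n, stirlingScale m (s + j * (b / 2))) *
        ∫ y : Fin n → ℝ, (∏ i, gammaProfile √m s (y i)) * absVandermonde y ^ b := by
  have hm0 : (0 : ℝ) < m := Nat.cast_pos.2 hm
  have hr : 0 < √(m : ℝ) := sqrt_pos.2 hm0
  set f : ℝ → ℝ := (Set.Ioi (0 : ℝ)).indicator fun x => x ^ (s + m) * exp (-x) with hf
  set F : (Fin n → ℝ) → ℝ := fun x => (∏ i, f (x i)) * absVandermonde x ^ b with hF
  have h1 : laguerreZ n (1 + s + m) b = ∫ x, F x := by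
    rw [laguerreZ, orthant_eq_restrict,
      ← integral_indicator (MeasurableSet.univ_pi fun _ => measurableSet_Ioi)]
    congr 1 with x
    by_cases hx : x ∈ Set.univ.pi fun _ : Fin n => Set.Ioi (0 : ℝ)
    · rw [Set.indicator_of_mem hx, hF, gammaWeight]
      simp only [hf]
      congr 1
      refine Finset.prod_congr rfl fun i _ => ?_
      rw [Set.indicator_of_mem (hx i trivial)]
      ring_nf
    · rw [Set.indicator_of_notMem hx, hF]
      simp only [Set.mem_univ_pi, not_forall] at hx
      obtain ⟨i, hi⟩ := hx
      simp only [hf]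
      rw [Finset.prod_eq_zero (Finset.mem_univ i) (Set.indicator_of_notMem hi _), zero_mul]
  have h2 : ∫ x, F x = √m ^ n * ∫ y : Fin n → ℝ, F (fun i => √m * y i + m) := by
    have h3 := Measure.integral_comp_smul (volume : Measure (Fin n → ℝ))
      (fun x => F (x + fun _ => (m : ℝ))) √m
    rw [integral_add_right_eq_self F] at h3
    simp only [Module.finrank_fintype_fun_eq_card, Fintype.card_fin, smul_eq_mul] at h3
    rw [abs_of_pos (by positivity)] at h3
    change ∫ y : Fin n → ℝ, F (fun i => √m * y i + m) = _ at h3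
    rw [h3, mul_inv_cancel_left₀ (by positivity)]
  have h4 : ∀ y : Fin n → ℝ, F (fun i => √m * y i + m)
      = ((∏ j : Fin n, ((m : ℝ) ^ s * ((m : ℝ) ^ m * exp (-m))) * (m : ℝ) ^ ((j : ℕ) * (b / 2)))) *
        ((∏ i, gammaProfile √m s (y i)) * absVandermonde y ^ b) := fun y => by
    simp only [hF, hf, indicator_eq_gammaProfile hm, absVandermonde_affine]
    rw [mul_rpow (Finset.prod_nonneg fun _ _ => by positivity) (absVandermonde_nonneg y),
      ← finsetProd_rpow _ _ fun _ _ => by positivity]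
    have h5 : ∀ j : Fin n, (|√(m : ℝ)| ^ (j : ℕ)) ^ b = (m : ℝ) ^ ((j : ℕ) * (b / 2)) := fun j => by
      rw [abs_of_pos hr, sqrt_eq_rpow, ← rpow_natCast, ← rpow_mul hm0.le, ← rpow_mul hm0.le]
      ring_nf
    simp only [h5, Finset.prod_mul_distrib]
    ring
  rw [h1, h2]
  simp only [h4]
  rw [integral_const_mul, ← mul_assoc]
  congr 1
  rw [Finset.prod_range, ← Fin.prod_const, ← Finset.prod_mul_distrib]
  refine Finset.prod_congr rfl fun j _ => ?_
  rw [stirlingScale, rpow_add hm0]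
  ring

lemma tendsto_laguerreZ_div (n : ℕ) {s b : ℝ} (hs : 0 ≤ s) (hb : 0 ≤ b) :
    Filter.Tendsto (fun m : ℕ => laguerreZ n (1 + s + m) b /
      ∏ j ∈ Finset.range n, stirlingScale m (s + j * (b / 2))) Filter.atTop
      (nhds (gaussZ n b)) := by
  obtain ⟨k, hk⟩ := absVandermonde_rpow_le_growth (n := n) hb
  have hsqrt : Filter.Tendsto (fun m : ℕ => √(m : ℝ)) Filter.atTop Filter.atTop :=
    tendsto_sqrt_atTop.comp tendsto_natCast_atTop_atTop
  have hlim : Filter.Tendsto (fun m : ℕ => ∫ y : Fin n → ℝ,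
      (∏ i, gammaProfile √m s (y i)) * absVandermonde y ^ b) Filter.atTop (nhds (gaussZ n b)) := by
    refine tendsto_integral_filter_of_dominated_convergence
      (fun y => exp 1 ^ n * (growth y ^ (⌈s⌉₊ + k) * exp (-((∑ i, |y i|) / 2)))) ?_ ?_
      ((integrable_growth_pow_mul_exp _).const_mul _) ?_
    · refine .of_forall fun m => Measurable.aestronglyMeasurable ?_
      have h1 := measurable_absVandermonde (n := n)
      have h2 := measurable_gammaProfile √m s
      fun_prop
    · filter_upwards [Filter.eventually_ge_atTop 1] with m hm
      refine .of_forall fun y => ?_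
      have hu : 1 ≤ √(m : ℝ) := one_le_sqrt.2 (by exact_mod_cast hm)
      rw [norm_of_nonneg (mul_nonneg (Finset.prod_nonneg fun _ _ => gammaProfile_nonneg _ _ _)
        (rpow_nonneg (absVandermonde_nonneg y) b))]
      calc (∏ i, gammaProfile √m s (y i)) * absVandermonde y ^ b
          ≤ (∏ i, exp 1 * ((1 + |y i|) ^ ⌈s⌉₊ * exp (-(|y i| / 2)))) * growth y ^ k :=
            mul_le_mul (Finset.prod_le_prod (fun _ _ => gammaProfile_nonneg _ _ _)
              fun i _ => gammaProfile_le hu hs (y i)) (hk y)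
              (rpow_nonneg (absVandermonde_nonneg y) b)
              (Finset.prod_nonneg fun _ _ => by positivity)
        _ = _ := by
            simp only [Finset.prod_mul_distrib, Finset.prod_const, Finset.card_univ,
              Fintype.card_fin, Finset.prod_pow, ← exp_sum, Finset.sum_neg_distrib, pow_add,
              Finset.sum_div, growth]
            ring
    · refine .of_forall fun y => Filter.Tendsto.mul_const _ (tendsto_finsetProd _ fun i _ => ?_)
      exact (tendsto_gammaProfile s (y i)).comp hsqrt
  refine hlim.congr' ?_
  filter_upwards [Filter.eventually_gt_atTop 0] with m hm
  rw [laguerreZ_eq_scaled n hm, mul_div_cancel_left₀]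
  exact (Finset.prod_pos fun _ _ => stirlingScale_pos hm _).ne'

lemma absVandermonde_fin_one (x : Fin 1 → ℝ) : absVandermonde x = 1 := by
  simp [absVandermonde]

lemma gaussZ_one (b : ℝ) : gaussZ 1 b = √(2 * π) := by
  simp only [gaussZ, absVandermonde_fin_one, one_rpow, mul_one, Fin.prod_univ_one]
  refine ((volume_preserving_funUnique (Fin 1) ℝ).integral_comp'
    (g := fun t : ℝ => exp (-(t ^ 2 / 2)))).trans ?_
  have h := integral_gaussian (1 / 2)
  rw [show π / (1 / 2) = 2 * π by ring] at h
  rw [← h]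
  congr 1 with t
  ring_nf

lemma laguerreZ_one {a : ℝ} (ha : 0 < a) (b : ℝ) : laguerreZ 1 a b = Gamma a := by
  simp only [laguerreZ, absVandermonde_fin_one, one_rpow, mul_one, gammaWeight, Fin.prod_univ_one]
  rw [orthant_eq_restrict, Gamma_eq_integral ha]
  have h := (volume_preserving_funUnique (Fin 1) ℝ).setIntegral_preimage_emb
    (MeasurableEquiv.measurableEmbedding _) (fun t : ℝ => t ^ (a - 1) * exp (-t)) (Set.Ioi 0)
  rw [show (Set.univ.pi fun _ : Fin 1 => Set.Ioi (0 : ℝ))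
    = MeasurableEquiv.funUnique (Fin 1) ℝ ⁻¹' Set.Ioi 0 by
      ext x; simp [Fin.forall_fin_one]]
  refine Eq.trans h ?_
  simp only [mul_comm]

lemma tendsto_Gamma_div_stirlingScale {v : ℝ} (hv : 0 ≤ v) :
    Filter.Tendsto (fun m : ℕ => Gamma (1 + v + m) / stirlingScale m v) Filter.atTop
      (nhds √(2 * π)) := by
  have h := tendsto_laguerreZ_div 1 hv (le_refl (0 : ℝ))
  rw [gaussZ_one] at h
  refine h.congr fun m => ?_
  rw [laguerreZ_one (by positivity)]
  simp

lemma laguerreZ_eq (n : ℕ) {s b : ℝ} (hs : 0 ≤ s) (hb : 1 < b) :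
    laguerreZ n (1 + s) b
      = gaussZ n b / √(2 * π) ^ n * ∏ j ∈ Finset.range n, Gamma (1 + s + j * (b / 2)) := by
  have hpos : ∀ (m j : ℕ), 0 < Gamma (1 + s + m + j * (b / 2)) := fun m j =>
    Gamma_pos_of_pos (by positivity)
  have hper : ∀ m : ℕ, laguerreZ n (1 + s + m) b /
      ∏ j ∈ Finset.range n, Gamma (1 + s + m + j * (b / 2))
      = laguerreZ n (1 + s) b / ∏ j ∈ Finset.range n, Gamma (1 + s + j * (b / 2)) := by
    intro m
    induction m with
    | zero => simp
    | succ m ih =>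
      rw [← ih]
      have h1 : ∀ j ∈ Finset.range n, Gamma (1 + s + (m + 1 : ℕ) + j * (b / 2))
          = (1 + s + m + j * (b / 2)) * Gamma (1 + s + m + j * (b / 2)) := fun j _ => by
        rw [← Gamma_add_one (by positivity)]
        push_cast
        ring_nf
      rw [Finset.prod_congr rfl h1, Finset.prod_mul_distrib, Nat.cast_succ, ← add_assoc,
        laguerreZ_add_one n (by linarith [(Nat.cast_nonneg m : (0 : ℝ) ≤ m)]) hb,
        mul_div_mul_left]
      exact (Finset.prod_pos fun j _ => by positivity).ne'
  have hlim1 := tendsto_laguerreZ_div n hs (by linarith : 0 ≤ b)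
  have hlim2 : Filter.Tendsto (fun m : ℕ => ∏ j ∈ Finset.range n,
      Gamma (1 + s + m + j * (b / 2)) / stirlingScale m (s + j * (b / 2))) Filter.atTop
      (nhds (∏ j ∈ Finset.range n, √(2 * π))) := by
    refine tendsto_finsetProd _ fun j _ => ?_
    refine (tendsto_Gamma_div_stirlingScale (v := s + j * (b / 2)) (by positivity)).congr
      fun m => ?_
    ring_nf
  rw [Finset.prod_const, Finset.card_range] at hlim2
  have hlim3 := hlim1.div hlim2 (by positivity)
  have hconst := tendsto_nhds_unique (hlim3.congr' ?_) (tendsto_const_nhds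
    (x := laguerreZ n (1 + s) b / ∏ j ∈ Finset.range n, Gamma (1 + s + j * (b / 2))))
  · rw [hconst, div_mul_cancel₀]
    exact (Finset.prod_pos fun j _ => by simpa using hpos 0 j).ne'
  · filter_upwards [Filter.eventually_gt_atTop 0] with m hm
    rw [← hper m, Pi.div_apply, Finset.prod_div_distrib, div_div_div_cancel_right₀]
    exact (Finset.prod_pos fun _ _ => stirlingScale_pos hm _).ne'

/-- The Mehta integral for `b > 1`. -/
lemma gaussZ_eq (n : ℕ) {b : ℝ} (hb : 1 < b) :
    gaussZ n b = √(2 * π) ^ n *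
      ∏ j ∈ Finset.range n, Gamma (1 + (j + 1 : ℕ) * (b / 2)) / Gamma (1 + b / 2) := by
  have hpos : ∀ j : ℕ, 0 < Gamma (1 + j * (b / 2)) := fun j => Gamma_pos_of_pos (by positivity)
  have hg1 : 0 < Gamma (1 + b / 2) := by simpa using hpos 1
  induction n with
  | zero =>
    simp [gaussZ, absVandermonde, integral_const, measureReal_def, volume_pi]
  | succ n ih =>
    have h1 := laguerreZ_succ_one n hb
    have h2 := laguerreZ_eq (n + 1) le_rfl hb
    have h3 := laguerreZ_eq n (by linarith : 0 ≤ b) hb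
    rw [add_zero] at h2
    rw [h2, h3, Finset.prod_range_succ'] at h1
    have h4 : ∀ j ∈ Finset.range n, Gamma (1 + b + j * (b / 2))
        = Gamma (1 + (j + 1 + 1 : ℕ) * (b / 2)) := fun j _ => by push_cast; ring_nf
    rw [Finset.prod_congr rfl h4] at h1
    have h5 := Finset.prod_range_succ (fun j => Gamma (1 + (j + 1 : ℕ) * (b / 2))) n
    rw [Finset.prod_range_succ'] at h5
    simp only [Nat.cast_zero, zero_add, zero_mul, add_zero, Gamma_one, mul_one, Nat.cast_one,
      one_mul] at h1 h5
    have hP : 0 < ∏ j ∈ Finset.range n, Gamma (1 + (j + 1 : ℕ) * (b / 2)) :=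
      Finset.prod_pos fun j _ => hpos _
    have hw : 0 < √(2 * π) := by positivity
    rw [Finset.prod_range_succ, ← mul_assoc, pow_succ]
    have h6 : gaussZ (n + 1) b / √(2 * π) ^ (n + 1)
        = gaussZ n b / √(2 * π) ^ n * (Gamma (1 + (n + 1 : ℕ) * (b / 2)) / Gamma (1 + b / 2)) := by
      rw [← mul_right_cancel_iff_of_pos hP, h1, eq_div_iff hg1.ne' |>.2 h5]
      ring
    rw [div_eq_iff (by positivity)] at h6
    rw [h6, ih, pow_succ, mul_div_cancel_left₀ _ (by positivity : √(2 * π) ^ n ≠ 0)]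
    ring

/-- Two functions on `ℂ` agreeing at all reals above `u` agree frequently near any such real. -/
lemma frequently_eq_of_forall_ofReal {f g : ℂ → ℂ} {u c : ℝ} (hc : u < c)
    (h : ∀ s > u, f (s : ℝ) = g (s : ℝ)) : ∃ᶠ z in nhdsWithin (c : ℂ) {(c : ℂ)}ᶜ, f z = g z := by
  have htend : Filter.Tendsto (fun s : ℝ => (s : ℂ)) (nhdsWithin c (Set.Ioi c))
      (nhdsWithin (c : ℂ) {(c : ℂ)}ᶜ) := by
    refine tendsto_nhdsWithin_iff.2
      ⟨(Complex.continuous_ofReal.tendsto c).mono_left nhdsWithin_le_nhds, ?_⟩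
    filter_upwards [self_mem_nhdsWithin] with s hs
    simpa using (Set.mem_Ioi.1 hs).ne'
  refine htend.frequently (Filter.Eventually.frequently ?_)
  filter_upwards [self_mem_nhdsWithin] with s hs
  exact h s (hc.trans hs)

open ProbabilityTheory in
/-- If the moment generating function of `X` is finite on `(u, ∞)` and continues holomorphically to
the half-plane `a < re z`, then it is finite on `(a, ∞)` (Landau). -/
lemma integrableExpSet_of_differentiableOn {Ω : Type*} [MeasurableSpace Ω] {μ : Measure Ω}
    {X : Ω → ℝ} {a u : ℝ} {F : ℂ → ℂ} (hInt : Set.Ioi u ⊆ integrableExpSet X μ)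
    (hF : DifferentiableOn ℂ F {z | a < z.re}) (h : ∀ t > u, (mgf X μ t : ℂ) = F t) :
    Set.Ioi a ⊆ integrableExpSet X μ := by
  intro t ht
  rw [Set.mem_Ioi] at ht
  rcases lt_or_ge u t with hut | hut
  · exact hInt hut
  have hopen : ∀ x : ℝ, IsOpen {z : ℂ | x < z.re} :=
    fun x => isOpen_lt continuous_const Complex.continuous_re
  have hIoi : Set.Ioi u ⊆ interior (integrableExpSet X μ) := interior_maximal hInt isOpen_Ioi
  have hau : a < u := ht.trans_le hut
  set c : ℝ := u + 1 with hc
  have hcu : u < c := by linarith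
  have hci : (c : ℂ).re ∈ interior (integrableExpSet X μ) := hIoi hcu
  have heq : Set.EqOn (complexMGF X μ) F {z | u < z.re} := by
    refine AnalyticOnNhd.eqOn_of_preconnected_of_frequently_eq (z₀ := (c : ℂ))
      (analyticOnNhd_complexMGF.mono fun z hz => hIoi hz)
      ((hF.mono fun z (hz : u < z.re) => hau.trans hz).analyticOnNhd (hopen u))
      (convex_halfSpace_re_gt u).isPreconnected hcu ?_
    exact frequently_eq_of_forall_ofReal hcu fun s hs => by rw [complexMGF_ofReal, h s hs]
  have hball : Metric.ball (c : ℂ) (c - a) ⊆ {z | a < z.re} := by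
    intro z hz
    rw [Metric.mem_ball, dist_eq_norm, norm_sub_rev] at hz
    have := (Complex.re_le_norm _).trans_lt hz
    simp only [Complex.sub_re, Complex.ofReal_re] at this
    show a < z.re
    linarith
  have htb : (t : ℂ) ∈ Metric.ball (c : ℂ) (c - a) := by
    rw [Metric.mem_ball, dist_eq_norm, ← Complex.ofReal_sub, Complex.norm_real, norm_eq_abs,
      abs_lt]
    constructor <;> linarith
  have hsum := (Complex.hasSum_taylorSeries_on_ball (hF.mono hball) htb).summable.norm
  have hder : ∀ m : ℕ, iteratedDeriv m F c = (∫ ω, X ω ^ m * exp (c * X ω) ∂μ : ℝ) := by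
    intro m
    rw [← (heq.eventuallyEq_of_mem ((hopen u).mem_nhds hcu)).iteratedDeriv_eq,
      iteratedDeriv_complexMGF hci, ← integral_complex_ofReal]
    simp
  have hsum2 := hsum.comp_injective (i := fun m : ℕ => 2 * m) fun _ _ => by simp
  have hX : AEMeasurable X μ := aemeasurable_of_mem_interior_integrableExpSet hci
  have hterm : ∀ (m : ℕ) ω, 0 ≤ ((t - c) * X ω) ^ (2 * m) / (2 * m).factorial * exp (c * X ω) :=
    fun m ω => mul_nonneg (div_nonneg (Even.pow_nonneg (by simp) _) (by positivity)) (exp_pos _).le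
  have hfin : Integrable (fun ω => cosh ((t - c) * X ω) * exp (c * X ω)) μ := by
    refine ⟨AEMeasurable.aestronglyMeasurable (by fun_prop), ?_⟩
    rw [hasFiniteIntegral_iff_ofReal (.of_forall fun ω => by positivity [cosh_pos ((t - c) * X ω)])]
    have hpt : ∀ ω, ENNReal.ofReal (cosh ((t - c) * X ω) * exp (c * X ω)) = ∑' m : ℕ,
        ENNReal.ofReal (((t - c) * X ω) ^ (2 * m) / (2 * m).factorial * exp (c * X ω)) := by
      intro ω
      have hs := (Real.hasSum_cosh ((t - c) * X ω)).mul_right (exp (c * X ω))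
      rw [← hs.tsum_eq, ENNReal.ofReal_tsum_of_nonneg (fun m => hterm m ω) hs.summable]
    simp_rw [hpt]
    rw [lintegral_tsum fun m => by fun_prop]
    refine lt_of_eq_of_lt (tsum_congr fun m => ?_) hsum2.tsum_ofReal_lt_top
    have hint2 : Integrable
        (fun ω => ((t - c) * X ω) ^ (2 * m) / (2 * m).factorial * exp (c * X ω)) μ := by
      refine ((integrable_pow_mul_exp_of_mem_interior_integrableExpSet hci (2 * m)).const_mul
        ((t - c) ^ (2 * m) / (2 * m).factorial)).congr (.of_forall fun ω => ?_)
      simp only [Complex.ofReal_re, mul_pow]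
      ring
    rw [← ofReal_integral_eq_lintegral_ofReal hint2 (.of_forall fun ω => hterm m ω)]
    congr 1
    rw [← norm_of_nonneg (integral_nonneg fun ω => hterm m ω), Function.comp_apply, hder]
    have : ∫ ω, ((t - c) * X ω) ^ (2 * m) / (2 * m).factorial * exp (c * X ω) ∂μ
        = ((2 * m).factorial : ℝ)⁻¹ * ((t - c) ^ (2 * m) *
          ∫ ω, X ω ^ (2 * m) * exp (c * X ω) ∂μ) := by
      rw [← integral_const_mul, ← integral_const_mul]
      congr 1 with ω
      rw [mul_pow]
      ring
    rw [this, ← Complex.norm_real]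
    push_cast
    rfl
  refine (hfin.const_mul 2).mono' (AEMeasurable.aestronglyMeasurable (by fun_prop))
    (.of_forall fun ω => ?_)
  rw [norm_of_nonneg (exp_pos _).le, cosh_eq]
  have : exp (t * X ω) = exp ((t - c) * X ω) * exp (c * X ω) := by rw [← exp_add]; ring_nf
  rw [this]
  nlinarith [mul_pos (exp_pos (-((t - c) * X ω))) (exp_pos (c * X ω))]

open ProbabilityTheory in
/-- Analytic continuation of a formula for a moment generating function. -/
lemma mgf_eq_of_differentiableOn {Ω : Type*} [MeasurableSpace Ω] {μ : Measure Ω}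
    {X : Ω → ℝ} {a u : ℝ} {F : ℂ → ℂ} (hInt : Set.Ioi u ⊆ integrableExpSet X μ)
    (hF : DifferentiableOn ℂ F {z | a < z.re}) (h : ∀ t > u, (mgf X μ t : ℂ) = F t)
    {t : ℝ} (ht : a < t) : (mgf X μ t : ℂ) = F t := by
  have hIoi : Set.Ioi a ⊆ interior (integrableExpSet X μ) :=
    interior_maximal (integrableExpSet_of_differentiableOn hInt hF h) isOpen_Ioi
  have hc : max a u < max a u + 1 := by linarith
  rw [← complexMGF_ofReal]
  refine AnalyticOnNhd.eqOn_of_preconnected_of_frequently_eq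
    (z₀ := ((max a u + 1 : ℝ) : ℂ)) (U := {z : ℂ | a < z.re})
    (analyticOnNhd_complexMGF.mono fun z hz => hIoi hz)
    (hF.analyticOnNhd (isOpen_lt continuous_const Complex.continuous_re))
    (convex_halfSpace_re_gt a).isPreconnected ((le_max_left a u).trans_lt hc) ?_ ht
  exact frequently_eq_of_forall_ofReal hc fun s hs => by
    rw [complexMGF_ofReal, h s ((le_max_right a u).trans_lt hs)]

lemma ae_absVandermonde_pos (n : ℕ) : ∀ᵐ x : Fin n → ℝ, 0 < absVandermonde x := by
  have h : ∀ i j : Fin n, i ≠ j → ∀ᵐ x : Fin n → ℝ, x i ≠ x j := by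
    intro i j hij
    have hne :
        LinearMap.ker ((LinearMap.proj i : (Fin n → ℝ) →ₗ[ℝ] ℝ) - LinearMap.proj j) ≠ ⊤ := by
      intro htop
      have : (Pi.single i 1 : Fin n → ℝ) ∈
          LinearMap.ker ((LinearMap.proj i : (Fin n → ℝ) →ₗ[ℝ] ℝ) - LinearMap.proj j) := by
        rw [htop]; trivial
      simp [hij.symm] at this
    rw [ae_iff]
    convert! Measure.addHaar_submodule volume _ hne using 2
    ext x
    simp [sub_eq_zero]
  have h' : ∀ᵐ x : Fin n → ℝ, ∀ i j, i ≠ j → x i ≠ x j := by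
    simpa only [ae_all_iff] using h
  filter_upwards [h'] with x hx
  refine abs_pos.2 (Matrix.det_vandermonde_ne_zero_iff.2 fun i j hij => ?_)
  by_contra hne
  exact hx i j hne hij

/-- The measure on `ℝⁿ` with density `exp (-|x|² / 2)`. -/
noncomputable def gaussMeasure (n : ℕ) : Measure (Fin n → ℝ) :=
  volume.withDensity fun x => ENNReal.ofReal (∏ i, exp (-(x i ^ 2 / 2)))

lemma integral_gaussMeasure {n : ℕ} (f : (Fin n → ℝ) → ℝ) :
    ∫ x, f x ∂gaussMeasure n = ∫ x, (∏ i, exp (-(x i ^ 2 / 2))) * f x := by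
  rw [gaussMeasure, integral_withDensity_eq_integral_toReal_smul₀
    (Measurable.aemeasurable (by fun_prop))
    (.of_forall fun _ => ENNReal.ofReal_lt_top)]
  congr 1 with x
  rw [ENNReal.toReal_ofReal (Finset.prod_nonneg fun _ _ => (exp_pos _).le), smul_eq_mul]

lemma ae_exp_mul_log_absVandermonde (n : ℕ) (t : ℝ) :
    ∀ᵐ x : Fin n → ℝ, exp (t * log (absVandermonde x)) = absVandermonde x ^ t := by
  filter_upwards [ae_absVandermonde_pos n] with x hx
  rw [rpow_def_of_pos hx, mul_comm]

lemma mgf_log_absVandermonde (n : ℕ) (t : ℝ) :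
    ProbabilityTheory.mgf (fun x => log (absVandermonde x)) (gaussMeasure n) t = gaussZ n t := by
  rw [ProbabilityTheory.mgf, integral_gaussMeasure, gaussZ]
  refine integral_congr_ae ?_
  filter_upwards [ae_exp_mul_log_absVandermonde n t] with x hx
  rw [hx]

lemma integrable_gauss_mul_absVandermonde_rpow (n : ℕ) {t : ℝ} (ht : 0 ≤ t) :
    Integrable fun x : Fin n → ℝ => (∏ i, exp (-(x i ^ 2 / 2))) * absVandermonde x ^ t := by
  obtain ⟨k, hk⟩ := absVandermonde_rpow_le_growth (n := n) ht
  refine ((integrable_growth_pow_mul_exp (n := n) k).const_mul (exp 1 ^ n)).mono' ?_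
    (.of_forall fun x => ?_)
  · have := measurable_absVandermonde (n := n)
    exact Measurable.aestronglyMeasurable (by fun_prop)
  have h1 : ∏ i, exp (-(x i ^ 2 / 2)) ≤ exp 1 ^ n * exp (-((∑ i, |x i|) / 2)) := by
    rw [← exp_sum, ← exp_nat_mul, ← exp_add, exp_le_exp, mul_one, Finset.sum_div,
      ← Finset.sum_neg_distrib, ← sub_nonneg]
    have : (n : ℝ) = ∑ _i : Fin n, (1 : ℝ) := by simp
    rw [this, ← Finset.sum_add_distrib, ← Finset.sum_sub_distrib]
    refine Finset.sum_nonneg fun i _ => ?_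
    nlinarith [sq_abs (x i), sq_nonneg (|x i| - 1)]
  have h2 := absVandermonde_nonneg x
  have h3 : 0 ≤ ∏ i, exp (-(x i ^ 2 / 2)) := Finset.prod_nonneg fun _ _ => (exp_pos _).le
  have h4 := growth_pos x
  rw [norm_of_nonneg (by positivity)]
  calc _ ≤ exp 1 ^ n * exp (-((∑ i, |x i|) / 2)) * growth x ^ k := by gcongr; exact hk x
    _ = _ := by ring

lemma Ioi_subset_integrableExpSet (n : ℕ) :
    Set.Ioi 1 ⊆ ProbabilityTheory.integrableExpSet (fun x => log (absVandermonde x))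
      (gaussMeasure n) := by
  intro t ht
  rw [Set.mem_Ioi] at ht
  rw [ProbabilityTheory.integrableExpSet, Set.mem_ofPred_eq, gaussMeasure,
    integrable_withDensity_iff (by fun_prop) (.of_forall fun _ => ENNReal.ofReal_lt_top)]
  refine (integrable_gauss_mul_absVandermonde_rpow n (by linarith : 0 ≤ t)).congr ?_
  filter_upwards [ae_exp_mul_log_absVandermonde n t] with x hx
  rw [hx, ENNReal.toReal_ofReal (Finset.prod_nonneg fun _ _ => (exp_pos _).le), mul_comm]

lemma differentiableOn_prod_Gamma {n : ℕ} (hn : 2 ≤ n) : DifferentiableOn ℂ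
    (fun z : ℂ => (√(2 * π) : ℂ) ^ n * ∏ j ∈ Finset.range n,
      Complex.Gamma (1 + (j + 1 : ℕ) * (z / 2)) / Complex.Gamma (1 + z / 2))
    {z | -2 / (n : ℝ) < z.re} := by
  intro z hz
  rw [Set.mem_ofPred_eq] at hz
  have hn0 : (0 : ℝ) < n := by positivity
  rw [div_lt_iff₀ hn0] at hz
  have hre : ∀ j : ℕ, j ≤ n → 0 < (1 + (j : ℂ) * (z / 2)).re := by
    intro j hj
    have hre' : (1 + (j : ℂ) * (z / 2)).re = 1 + j * (z.re / 2) := by simp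
    rw [hre']
    have hj' : (j : ℝ) ≤ n := Nat.cast_le.2 hj
    rcases le_or_gt 0 z.re with h | h
    · positivity
    · nlinarith
  have hnat : ∀ w : ℂ, 0 < w.re → ∀ m : ℕ, w ≠ -m := by
    rintro w hw m rfl
    simp at hw
    linarith [(Nat.cast_nonneg m : (0 : ℝ) ≤ m)]
  have h1 : 0 < (1 + z / 2).re := by simpa using hre 1 (by omega)
  refine DifferentiableAt.differentiableWithinAt ?_
  refine (differentiableAt_const _).mul (DifferentiableAt.fun_finsetProd fun j hj => ?_)
  refine DifferentiableAt.div ?_ ?_ (Complex.Gamma_ne_zero_of_re_pos h1)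
  · exact (Complex.differentiableAt_Gamma _
      (hnat _ (hre (j + 1) (by simpa using Finset.mem_range.1 hj)))).fun_comp' z (by fun_prop)
  · exact (Complex.differentiableAt_Gamma _ (hnat _ h1)).fun_comp' z (by fun_prop)

/-- The Mehta integral on its full range of convergence. -/
lemma gaussZ_eq_of_lt {n : ℕ} (hn : 2 ≤ n) {b : ℝ} (hb : -2 / (n : ℝ) < b) :
    gaussZ n b = √(2 * π) ^ n *
      ∏ j ∈ Finset.range n, Gamma (1 + (j + 1 : ℕ) * (b / 2)) / Gamma (1 + b / 2) := by
  have hcast : ∀ t : ℝ, ((√(2 * π) ^ n * ∏ j ∈ Finset.range n,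
      Gamma (1 + (j + 1 : ℕ) * (t / 2)) / Gamma (1 + t / 2) : ℝ) : ℂ)
      = (√(2 * π) : ℂ) ^ n * ∏ j ∈ Finset.range n,
        Complex.Gamma (1 + (j + 1 : ℕ) * ((t : ℂ) / 2)) / Complex.Gamma (1 + (t : ℂ) / 2) := by
    intro t
    simp only [Complex.ofReal_mul, Complex.ofReal_pow, Complex.ofReal_prod, Complex.ofReal_div,
      ← Complex.Gamma_ofReal, Complex.ofReal_add, Complex.ofReal_one, Complex.ofReal_natCast,
      Complex.ofReal_ofNat]
  have h := mgf_eq_of_differentiableOn (Ioi_subset_integrableExpSet n)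
    (differentiableOn_prod_Gamma hn)
    (fun t ht => by rw [mgf_log_absVandermonde, gaussZ_eq n ht, hcast]) hb
  rw [mgf_log_absVandermonde, ← hcast] at h
  exact_mod_cast h

/-- Normalization constant of the Gaussian beta ensemble:
`∫ |D(λ)|^β exp(-p₂(λ)/2) dλ = (2π)^{n/2} ∏_{j=1}^n Γ(1+jβ/2)/Γ(1+β/2)`. -/
theorem gbe_normalization (n : ℕ) (hn : 2 ≤ n) (β : ℝ) (hβ : -2 / n < β) :
    ∫ l : Fin n → ℝ,
      |∏ p ∈ Finset.univ.filter (fun p : Fin n × Fin n => p.1 < p.2), (l p.2 - l p.1)| ^ β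
        * Real.exp (-(∑ j, l j ^ 2) / 2)
      = (2 * π) ^ ((n : ℝ) / 2) *
        ∏ j ∈ Finset.Icc 1 n, Real.Gamma (1 + j * β / 2) / Real.Gamma (1 + β / 2) := by
  have h := gaussZ_eq_of_lt hn hβ
  have hpow : √(2 * π) ^ n = (2 * π) ^ ((n : ℝ) / 2) := by
    rw [sqrt_eq_rpow, ← rpow_mul_natCast (by positivity)]
    congr 1
    ring
  have hprod : ∏ j ∈ Finset.range n, Gamma (1 + (j + 1 : ℕ) * (β / 2)) / Gamma (1 + β / 2)
      = ∏ j ∈ Finset.Icc 1 n, Gamma (1 + j * β / 2) / Gamma (1 + β / 2) := by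
    rw [Finset.range_eq_Ico, Finset.prod_Ico_add' (fun j : ℕ =>
      Gamma (1 + j * (β / 2)) / Gamma (1 + β / 2)) 0 n 1]
    refine Finset.prod_congr (by ext; simp) fun j _ => ?_
    rw [mul_div_assoc]
  rw [← hpow, ← hprod, ← h, gaussZ]
  congr 1 with l
  have hdet : absVandermonde l
      = |∏ p ∈ Finset.univ.filter (fun p : Fin n × Fin n => p.1 < p.2), (l p.2 - l p.1)| := by
    rw [absVandermonde, Matrix.det_vandermonde, Finset.prod_filter, Fintype.prod_prod_type]
    congr 1
    refine Finset.prod_congr rfl fun i _ => ?_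
    rw [← Finset.prod_filter]
    exact Finset.prod_congr (by ext; simp) fun _ _ => rfl
  rw [hdet, mul_comm, ← exp_sum, Finset.sum_neg_distrib, ← Finset.sum_div, neg_div]
end

section
/- Let n ≥ 2, β > -2/n, and let λ = (λ₁,…,λₙ) be distributed with density proportional to |D(λ)|^β exp(-p₂(λ)/2) on ℝⁿ (the Gaussian beta ensemble). Then the random variable n^{-1/2} Σ_{j=1}^n λ_j has standard normal distribution N(0,1). -/
open MeasureTheory ProbabilityTheory Real

/-- The unnormalized density of the Gaussian beta ensemble. -/
noncomputable def gbeWeight {n : ℕ} (β : ℝ) (l : Fin n → ℝ) : ℝ :=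
  |∏ p ∈ Finset.univ.filter (fun p : Fin n × Fin n => p.1 < p.2), (l p.2 - l p.1)| ^ β
    * Real.exp (-(∑ j, l j ^ 2) / 2)

lemma gbeWeight_nonneg {n : ℕ} (β : ℝ) (l : Fin n → ℝ) : 0 ≤ gbeWeight β l := by
  unfold gbeWeight; positivity

lemma measurable_gbeWeight {n : ℕ} (β : ℝ) : Measurable (gbeWeight (n := n) β) := by
  unfold gbeWeight; fun_prop

lemma integrable_abs_rpow_mul_exp_neg_mul_sq {b : ℝ} (hb : 0 < b) {s : ℝ} (hs : -1 < s) :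
    Integrable fun x : ℝ => |x| ^ s * exp (-b * x ^ 2) := by
  have hpos : IntegrableOn (fun x : ℝ => |x| ^ s * exp (-b * x ^ 2)) (Set.Ioi 0) :=
    (integrableOn_rpow_mul_exp_neg_mul_sq hb hs).congr_fun
      (fun x hx => by simp only [abs_of_pos (Set.mem_Ioi.1 hx)]) measurableSet_Ioi
  rw [← integrableOn_univ, ← @Set.Iio_union_Ici _ _ (0 : ℝ), integrableOn_union,
    integrableOn_Ici_iff_integrableOn_Ioi]
  refine ⟨?_, hpos⟩
  rw [← (Measure.measurePreserving_neg (volume : Measure ℝ)).integrableOn_comp_preimage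
      (Homeomorph.neg ℝ).measurableEmbedding]
  simpa [Function.comp_def] using hpos

/-- Every unordered pair is an edge of exactly two of the stars centred at the indices `i`. -/
lemma sq_abs_prod_sub_eq_prod_stars {m : ℕ} (l : Fin (m + 1) → ℝ) :
    |∏ p ∈ Finset.univ.filter (fun p : Fin (m + 1) × Fin (m + 1) => p.1 < p.2),
      (l p.2 - l p.1)| ^ 2 = ∏ i, ∏ k, |l (i.succAbove k) - l i| := by
  set h : Fin (m + 1) → Fin (m + 1) → ℝ := fun i j => if i < j then |l j - l i| else 1 with hh
  have h₁ : |∏ p ∈ Finset.univ.filter (fun p : Fin (m + 1) × Fin (m + 1) => p.1 < p.2),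
      (l p.2 - l p.1)| = ∏ i, ∏ j, h i j := by
    rw [Finset.abs_prod, Finset.prod_filter, Fintype.prod_prod_type]
  have h₂ : ∏ i, ∏ j, h i j = ∏ i, ∏ j, h j i := Finset.prod_comm
  rw [h₁, sq]
  nth_rewrite 2 [h₂]
  rw [← Finset.prod_mul_distrib]
  refine Finset.prod_congr rfl fun i _ => ?_
  rw [← Finset.prod_mul_distrib, Fin.prod_univ_succAbove _ i]
  have hii : h i i * h i i = 1 := by simp [hh]
  rw [hii, one_mul]
  refine Finset.prod_congr rfl fun k _ => ?_
  rcases lt_or_gt_of_ne (Fin.succAbove_ne i k) with hk | hk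
  · simp [hh, hk, not_lt.2 hk.le, abs_sub_comm]
  · simp [hh, hk, not_lt.2 hk.le]

lemma gbeWeight_le_sum_stars {m : ℕ} (β : ℝ) (l : Fin (m + 1) → ℝ) :
    gbeWeight β l ≤ ∑ i, (∏ k, |l (i.succAbove k) - l i| ^ ((m + 1) * β / 2)) *
      exp (-(∑ j, l j ^ 2) / 2) := by
  rw [← Finset.sum_mul, gbeWeight]
  refine mul_le_mul_of_nonneg_right ?_ (exp_pos _).le
  have hm : (0 : ℝ) < m + 1 := by positivity
  set V := ∏ p ∈ Finset.univ.filter (fun p : Fin (m + 1) × Fin (m + 1) => p.1 < p.2),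
    (l p.2 - l p.1)
  have hV : |V| ^ β = ∏ i, (∏ k, |l (i.succAbove k) - l i| ^ ((m + 1) * β / 2)) ^
      ((m + 1 : ℝ)⁻¹) := by
    have : |V| ^ β = (|V| ^ 2) ^ (β / 2) := by
      rw [← Real.rpow_natCast, ← Real.rpow_mul (abs_nonneg _)]
      congr 1; push_cast; ring
    rw [this, sq_abs_prod_sub_eq_prod_stars,
      ← Real.finsetProd_rpow _ _ (fun _ _ => by positivity)]
    refine Finset.prod_congr rfl fun i _ => ?_
    rw [Real.finsetProd_rpow _ _ (fun _ _ => by positivity), ← Real.rpow_mul (by positivity)]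
    congr 1; field_simp
  rw [hV]
  refine (Real.geom_mean_le_arith_mean_weighted Finset.univ (fun _ => (m + 1 : ℝ)⁻¹) _
    (fun _ _ => by positivity) ?_ (fun _ _ => by positivity)).trans ?_
  · simp [hm.ne']
  · refine Finset.sum_le_sum fun i _ => mul_le_of_le_one_left (by positivity) ?_
    exact inv_le_one_of_one_le₀ (by linarith [(Nat.cast_nonneg m : (0 : ℝ) ≤ m)])

lemma star_mul_exp_le {m : ℕ} (c : ℝ) (l : Fin (m + 1) → ℝ) (i : Fin (m + 1)) :
    (∏ k, |l (i.succAbove k) - l i| ^ c) * exp (-(∑ j, l j ^ 2) / 2) ≤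
      exp (-(1 / (2 * (m + 1))) * l i ^ 2) * ∏ k, (|l (i.succAbove k) - l i| ^ c *
        exp (-(1 / (4 * (m + 1))) * (l (i.succAbove k) - l i) ^ 2)) := by
  rw [Finset.prod_mul_distrib, mul_left_comm, ← Real.exp_sum, ← Real.exp_add]
  refine mul_le_mul_of_nonneg_left (Real.exp_le_exp.2 ?_) (by positivity)
  have hm : (0 : ℝ) < m + 1 := by positivity
  set θ : ℝ := 1 / (4 * (m + 1)) with hθ
  have hθ0 : 0 < θ := by positivity
  have hθ1 : θ ≤ 1 / 4 := by
    rw [hθ]; gcongr; linarith [(Nat.cast_nonneg m : (0 : ℝ) ≤ m)]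
  have hθm : θ * (m + 1) = 1 / 4 := by rw [hθ]; field_simp
  have hθ2 : 1 / (2 * (m + 1) : ℝ) = 2 * θ := by rw [hθ]; field_simp; norm_num
  have hk : ∑ k, (-θ * (l (i.succAbove k) - l i) ^ 2) ≥
      ∑ k, (-(l (i.succAbove k) ^ 2) / 2 - 2 * θ * l i ^ 2) := by
    refine Finset.sum_le_sum fun k _ => ?_
    nlinarith [mul_nonneg hθ0.le (sq_nonneg (l (i.succAbove k) + l i)),
      mul_nonneg (sub_nonneg.2 hθ1) (sq_nonneg (l (i.succAbove k)))]
  rw [Finset.sum_sub_distrib, ← Finset.sum_div, Finset.sum_neg_distrib] at hk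
  simp only [Finset.sum_const, Finset.card_univ, Fintype.card_fin, nsmul_eq_mul] at hk
  rw [Fin.sum_univ_succAbove _ i, hθ2]
  have : l i ^ 2 * (θ * (m + 1)) = l i ^ 2 * (1 / 4) := by rw [hθm]
  linarith

lemma integrable_star {m : ℕ} {c : ℝ} (hc : -1 < c) (i : Fin (m + 1)) :
    Integrable fun l : Fin (m + 1) → ℝ =>
      exp (-(1 / (2 * (m + 1))) * l i ^ 2) * ∏ k, (|l (i.succAbove k) - l i| ^ c *
        exp (-(1 / (4 * (m + 1))) * (l (i.succAbove k) - l i) ^ 2)) := by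
  have hprod : Integrable (fun z : ℝ × (Fin m → ℝ) =>
      exp (-(1 / (2 * (m + 1))) * z.1 ^ 2) * ∏ k, (|z.2 k| ^ c *
        exp (-(1 / (4 * (m + 1))) * z.2 k ^ 2))) (volume.prod volume) :=
    (integrable_exp_neg_mul_sq (by positivity)).mul_prod
      (Integrable.fintype_prod fun _ : Fin m =>
        integrable_abs_rpow_mul_exp_neg_mul_sq (by positivity) hc)
  have hshear : MeasurePreserving (fun z : ℝ × (Fin m → ℝ) => (z.1, z.2 - fun _ => z.1))
      (volume.prod volume) (volume.prod volume) :=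
    MeasurePreserving.skew_product (g := fun x y => y - fun _ => x) (MeasurePreserving.id volume)
      (by unfold Function.uncurry; fun_prop)
      (Filter.Eventually.of_forall fun x => (measurePreserving_sub_right volume _).map_eq)
  exact (hshear.comp
    (volume_preserving_piFinSuccAbove (fun _ => ℝ) i)).integrable_comp_of_integrable hprod

lemma integrable_gbeWeight {n : ℕ} (hn : n ≠ 0) {β : ℝ} (hβ : -2 / n < β) :
    Integrable (gbeWeight (n := n) β) := by
  obtain ⟨m, rfl⟩ := Nat.exists_eq_succ_of_ne_zero hn
  have hc : -1 < (m + 1) * β / 2 := by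
    rw [div_lt_iff₀ (by positivity)] at hβ
    push_cast at hβ
    linarith
  refine (integrable_finsetSum Finset.univ fun i _ => integrable_star hc i).mono'
    (measurable_gbeWeight β).aestronglyMeasurable (Filter.Eventually.of_forall fun l => ?_)
  rw [Real.norm_of_nonneg (gbeWeight_nonneg β l)]
  exact (gbeWeight_le_sum_stars β l).trans (Finset.sum_le_sum fun i _ => star_mul_exp_le _ l i)

lemma integral_gbeWeight_pos {n : ℕ} (hn : n ≠ 0) {β : ℝ} (hβ : -2 / n < β) :
    0 < ∫ l : Fin n → ℝ, gbeWeight β l := by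
  rw [integral_pos_iff_support_of_nonneg (gbeWeight_nonneg β) (integrable_gbeWeight hn hβ)]
  have hopen : IsOpen {l : Fin n → ℝ |
      ∏ p ∈ Finset.univ.filter (fun p : Fin n × Fin n => p.1 < p.2), (l p.2 - l p.1) ≠ 0} :=
    isOpen_ne_fun (by fun_prop) continuous_const
  refine (hopen.measure_pos volume ⟨fun j => (j : ℝ), ?_⟩).trans_le (measure_mono fun l hl => ?_)
  · refine Finset.prod_ne_zero_iff.2 fun p hp => sub_ne_zero.2 ?_
    have : p.1 < p.2 := (Finset.mem_filter.1 hp).2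
    simpa [Fin.val_inj] using this.ne'
  · exact (mul_pos (Real.rpow_pos_of_pos (abs_pos.2 hl) _) (exp_pos _)).ne'

/-- Exponential tilting of the ensemble by the normalized sum is a translation along the
diagonal, up to the Gaussian factor. -/
lemma exp_mul_gbeWeight {n : ℕ} (hn : n ≠ 0) (β t : ℝ) (l : Fin n → ℝ) :
    gbeWeight β l * exp (t * ((√n)⁻¹ * ∑ j, l j)) =
      exp (t ^ 2 / 2) * gbeWeight β (l - fun _ => t * (√n)⁻¹) := by
  have hs : (n : ℝ) * ((√n)⁻¹) ^ 2 = 1 := by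
    rw [inv_pow, Real.sq_sqrt (Nat.cast_nonneg n)]
    exact mul_inv_cancel₀ (Nat.cast_ne_zero.2 hn)
  simp only [gbeWeight, Pi.sub_apply, sub_sub_sub_cancel_right]
  rw [mul_left_comm (exp (t ^ 2 / 2)), mul_assoc, ← Real.exp_add, ← Real.exp_add]
  congr 2
  simp only [sub_sq, Finset.sum_add_distrib, Finset.sum_sub_distrib, ← Finset.sum_mul,
    ← Finset.mul_sum, Finset.sum_const, Finset.card_univ, Fintype.card_fin, nsmul_eq_mul]
  linear_combination (t ^ 2 / 2) * hs

/-- A measure whose moment-generating function is that of a Gaussian is Gaussian. -/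
lemma eq_gaussianReal_of_mgf {ν : Measure ℝ} [IsProbabilityMeasure ν] {m : ℝ} {v : NNReal}
    (h : mgf id ν = mgf id (gaussianReal m v)) : ν = gaussianReal m v := by
  refine Measure.ext_of_complexMGF_id_eq (funext fun z => eqOn_complexMGF_of_mgf h ?_)
  simp [integrableExpSet_eq_of_mgf h]

/-- Under the Gaussian beta ensemble on `ℝⁿ`, the normalized linear statistic
`n^{-1/2} Σ_j λ_j` is a standard Gaussian. -/
theorem gbe_sum_gaussian (n : ℕ) (hn : 2 ≤ n) (β : ℝ) (hβ : -2 / n < β)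
    (Z : ℝ) (μ : Measure (Fin n → ℝ))
    (hZ : Z = ∫ l : Fin n → ℝ,
      |∏ p ∈ Finset.univ.filter (fun p : Fin n × Fin n => p.1 < p.2), (l p.2 - l p.1)| ^ β
        * Real.exp (-(∑ j, l j ^ 2) / 2))
    (hμ : μ = (volume : Measure (Fin n → ℝ)).withDensity fun l =>
      ENNReal.ofReal (Z⁻¹ *
        (|∏ p ∈ Finset.univ.filter (fun p : Fin n × Fin n => p.1 < p.2), (l p.2 - l p.1)| ^ β
          * Real.exp (-(∑ j, l j ^ 2) / 2)))) :
    Measure.map (fun l => (Real.sqrt n)⁻¹ * ∑ j, l j) μ = gaussianReal 0 1 := by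
  change Z = ∫ l : Fin n → ℝ, gbeWeight β l at hZ
  change μ = volume.withDensity fun l => ENNReal.ofReal (Z⁻¹ * gbeWeight β l) at hμ
  have hn0 : n ≠ 0 := by omega
  have hZpos : 0 < Z := hZ ▸ integral_gbeWeight_pos hn0 hβ
  have hdens : ∀ l : Fin n → ℝ, 0 ≤ Z⁻¹ * gbeWeight β l := fun l =>
    mul_nonneg (inv_nonneg.2 hZpos.le) (gbeWeight_nonneg β l)
  have hprob : IsProbabilityMeasure μ := by
    refine ⟨?_⟩
    rw [hμ, withDensity_apply _ MeasurableSet.univ, Measure.restrict_univ,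
      ← ofReal_integral_eq_lintegral_ofReal ((integrable_gbeWeight hn0 hβ).const_mul _)
        (Filter.Eventually.of_forall hdens), integral_const_mul, ← hZ,
      inv_mul_cancel₀ hZpos.ne', ENNReal.ofReal_one]
  have hmeas : Measurable fun l : Fin n → ℝ => (√n)⁻¹ * ∑ j, l j := by fun_prop
  have : IsProbabilityMeasure (μ.map fun l : Fin n → ℝ => (√n)⁻¹ * ∑ j, l j) :=
    Measure.isProbabilityMeasure_map hmeas.aemeasurable
  refine eq_gaussianReal_of_mgf ?_
  rw [mgf_id_map hmeas.aemeasurable, mgf_id_gaussianReal]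
  ext t
  rw [mgf, hμ, integral_withDensity_eq_integral_toReal_smul
    (((measurable_gbeWeight β).const_mul _).ennreal_ofReal)
    (Filter.Eventually.of_forall fun _ => ENNReal.ofReal_lt_top)]
  simp only [ENNReal.toReal_ofReal (hdens _), smul_eq_mul, mul_assoc, exp_mul_gbeWeight hn0]
  rw [integral_const_mul, integral_const_mul,
    integral_sub_right_eq_self (gbeWeight β) (fun _ => t * (√n)⁻¹), ← hZ]
  rw [mul_left_comm, inv_mul_cancel₀ hZpos.ne']
  simp
end

section
/- Let n ≥ 2, β > -2/n, and let λ be distributed as the Gaussian beta ensemble on ℝⁿ. Then (1/2) Σ_{j=1}^n λ_j² has the Gamma(d(β,n)/2, 1) distribution, where d(β,n) = n + n(n-1)β/2. -/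
open MeasureTheory ProbabilityTheory Real
open scoped ENNReal

theorem prod_filter_lt_eq_det_vandermonde {n : ℕ} (l : Fin n → ℝ) :
    ∏ p ∈ Finset.univ.filter (fun p : Fin n × Fin n => p.1 < p.2), (l p.2 - l p.1)
      = (Matrix.vandermonde l).det := by
  rw [Matrix.det_vandermonde, Finset.prod_filter, Fintype.prod_prod_type]
  refine Finset.prod_congr rfl fun i _ => ?_
  rw [← Finset.prod_filter]
  refine Finset.prod_congr ?_ fun _ _ => rfl
  ext j
  simp

theorem abs_det_vandermonde_comp_perm {n : ℕ} (l : Fin n → ℝ) (σ : Equiv.Perm (Fin n)) :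
    |(Matrix.vandermonde (l ∘ σ)).det| = |(Matrix.vandermonde l).det| := by
  have : Matrix.vandermonde (l ∘ σ) = (Matrix.vandermonde l).submatrix σ id := by
    ext i j
    simp [Matrix.vandermonde_apply]
  rw [this, Matrix.det_permute, abs_mul]
  rcases Int.units_eq_one_or (Equiv.Perm.sign σ) with h | h <;> simp [h]

theorem sum_card_Ioi_fin (n : ℕ) :
    ((∑ i : Fin n, (Finset.Ioi i).card : ℕ) : ℝ) = n * (n - 1) / 2 := by
  simp_rw [Fin.card_Ioi]
  rw [Fin.sum_univ_eq_sum_range (fun i => n - 1 - i) n, Finset.sum_range_reflect (fun i => i) n]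
  have h := Finset.sum_range_id_mul_two n
  rcases n with _ | m
  · simp
  · have h' : ((∑ i ∈ Finset.range (m + 1), i : ℕ) : ℝ) * 2 = (m + 1) * m := by exact_mod_cast h
    push_cast at h' ⊢
    linarith

theorem det_vandermonde_smul {n : ℕ} (c : ℝ) (l : Fin n → ℝ) :
    (Matrix.vandermonde (c • l)).det
      = c ^ (∑ i : Fin n, (Finset.Ioi i).card) * (Matrix.vandermonde l).det := by
  simp only [Matrix.det_vandermonde, Pi.smul_apply, smul_eq_mul, ← mul_sub,
    Finset.prod_mul_distrib, Finset.prod_const, Finset.prod_pow_eq_pow_sum]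

/-- The absolute Vandermonde determinant to a real power is homogeneous. -/
theorem abs_det_vandermonde_rpow_smul {n : ℕ} (β : ℝ) {c : ℝ} (hc : 0 < c) (l : Fin n → ℝ) :
    |(Matrix.vandermonde (c • l)).det| ^ β
      = c ^ (n * (n - 1) * β / 2) * |(Matrix.vandermonde l).det| ^ β := by
  rw [det_vandermonde_smul, abs_mul, mul_rpow (abs_nonneg _) (abs_nonneg _),
    abs_of_pos (by positivity),
    ← rpow_natCast, ← rpow_mul hc.le, sum_card_Ioi_fin]
  ring_nf

/-- For increasing points, the squared Vandermonde determinant dominates the product of the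
consecutive gaps, each raised to the number of points. -/
theorem prod_gap_pow_le_det_vandermonde_sq {m : ℕ} {l : Fin (m + 1) → ℝ} (hl : Monotone l) :
    ∏ k : Fin m, (l k.succ - l k.castSucc) ^ (m + 1) ≤ (Matrix.vandermonde l).det ^ 2 := by
  have hg : ∀ k : Fin m, 0 ≤ l k.succ - l k.castSucc := fun k =>
    sub_nonneg.2 (hl k.castSucc_lt_succ.le)
  have hleft : ∏ k : Fin m, (l k.succ - l k.castSucc) ^ (m - k : ℕ)
      ≤ (Matrix.vandermonde l).det := by
    rw [Matrix.det_vandermonde, Fin.prod_univ_castSucc]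
    have : Finset.Ioi (Fin.last m) = ∅ := by ext; simp [Fin.le_last]
    rw [this, Finset.prod_empty, mul_one]
    refine Finset.prod_le_prod (fun k _ => pow_nonneg (hg k) _) fun k _ => ?_
    have hc : (Finset.Ioi k.castSucc).card = m - k := by simp [Fin.card_Ioi]
    rw [← hc, ← Finset.prod_const]
    refine Finset.prod_le_prod (fun _ _ => hg k) fun j hj => ?_
    have : l k.succ ≤ l j := hl (Fin.castSucc_lt_iff_succ_le.1 (Finset.mem_Ioi.1 hj))
    linarith
  have hright : ∏ k : Fin m, (l k.succ - l k.castSucc) ^ (k + 1 : ℕ)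
      ≤ (Matrix.vandermonde l).det := by
    have hcomm : ∏ i, ∏ j ∈ Finset.Ioi i, (l j - l i) = ∏ j, ∏ i ∈ Finset.Iio j, (l j - l i) :=
      Finset.prod_comm' (by simp)
    rw [Matrix.det_vandermonde, hcomm, Fin.prod_univ_succ]
    have : Finset.Iio (0 : Fin (m + 1)) = ∅ := by ext; simp
    rw [this, Finset.prod_empty, one_mul]
    refine Finset.prod_le_prod (fun k _ => pow_nonneg (hg k) _) fun k _ => ?_
    have hc : (Finset.Iio k.succ).card = k + 1 := by simp [Fin.card_Iio]
    rw [← hc, ← Finset.prod_const]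
    refine Finset.prod_le_prod (fun _ _ => hg k) fun j hj => ?_
    have : l j ≤ l k.castSucc := hl (Fin.le_castSucc_iff.2 (Finset.mem_Iio.1 hj))
    linarith
  calc _ = (∏ k : Fin m, (l k.succ - l k.castSucc) ^ (m - k : ℕ))
        * ∏ k : Fin m, (l k.succ - l k.castSucc) ^ (k + 1 : ℕ) := by
        rw [← Finset.prod_mul_distrib]
        refine Finset.prod_congr rfl fun k _ => ?_
        rw [← pow_add]
        congr 1
        omega
    _ ≤ (Matrix.vandermonde l).det * (Matrix.vandermonde l).det :=
        mul_le_mul hleft hright (Finset.prod_nonneg fun k _ => pow_nonneg (hg k) _)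
          ((Finset.prod_nonneg fun k _ => pow_nonneg (hg k) _).trans hleft)
    _ = _ := (sq _).symm

theorem abs_det_vandermonde_rpow_le_of_monotone {m : ℕ} {β : ℝ} (hβ : β < 0)
    {l : Fin (m + 1) → ℝ} (hl : Monotone l) :
    |(Matrix.vandermonde l).det| ^ β
      ≤ ∏ k : Fin m, |l k.succ - l k.castSucc| ^ ((m + 1) * β / 2) := by
  rcases eq_or_ne (Matrix.vandermonde l).det 0 with h0 | h0
  · rw [h0, abs_zero, zero_rpow hβ.ne]
    exact Finset.prod_nonneg fun k _ => rpow_nonneg (abs_nonneg _) _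
  have hinj : Function.Injective l := Matrix.det_vandermonde_ne_zero_iff.1 h0
  have hg : ∀ k : Fin m, 0 < l k.succ - l k.castSucc := fun k =>
    sub_pos.2 (hl.strictMono_of_injective hinj k.castSucc_lt_succ)
  calc |(Matrix.vandermonde l).det| ^ β = ((Matrix.vandermonde l).det ^ 2) ^ (β / 2) := by
        rw [← sq_abs, ← rpow_natCast, ← rpow_mul (abs_nonneg _)]
        congr 1
        push_cast
        ring
    _ ≤ (∏ k : Fin m, (l k.succ - l k.castSucc) ^ (m + 1)) ^ (β / 2) :=
        rpow_le_rpow_of_nonpos (Finset.prod_pos fun k _ => pow_pos (hg k) _)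
          (prod_gap_pow_le_det_vandermonde_sq hl) (by linarith)
    _ = _ := by
        rw [← finsetProd_rpow _ _ fun k _ => (pow_pos (hg k) _).le]
        refine Finset.prod_congr rfl fun k _ => ?_
        rw [abs_of_pos (hg k), ← rpow_natCast, ← rpow_mul (hg k).le]
        congr 1
        push_cast
        ring

theorem abs_det_vandermonde_rpow_le_sum_perm {m : ℕ} {β : ℝ} (hβ : β < 0)
    (l : Fin (m + 1) → ℝ) :
    |(Matrix.vandermonde l).det| ^ β
      ≤ ∑ σ : Equiv.Perm (Fin (m + 1)),
        ∏ k : Fin m, |l (σ k.succ) - l (σ k.castSucc)| ^ ((m + 1) * β / 2) := by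
  rw [← abs_det_vandermonde_comp_perm l (Tuple.sort l)]
  refine (abs_det_vandermonde_rpow_le_of_monotone hβ (Tuple.monotone_sort l)).trans ?_
  exact Finset.single_le_sum
    (f := fun σ : Equiv.Perm (Fin (m + 1)) =>
      ∏ k : Fin m, |l (σ k.succ) - l (σ k.castSucc)| ^ ((m + 1) * β / 2))
    (fun σ _ => Finset.prod_nonneg fun k _ => rpow_nonneg (abs_nonneg _) _)
    (Finset.mem_univ (Tuple.sort l))

/-- A chain of convolution-type factors integrates to at most a power of a uniform one-variable
bound. -/
theorem lintegral_chain_le {f g : ℝ → ℝ≥0∞} (hf : Measurable f) (hg : Measurable g) {C : ℝ≥0∞}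
    (hgC : ∫⁻ x, g x ≤ C) (hfC : ∀ y, ∫⁻ x, f (y - x) * g x ≤ C) (m : ℕ) :
    ∫⁻ l : Fin (m + 1) → ℝ, (∏ k : Fin m, f (l k.succ - l k.castSucc)) * ∏ j, g (l j)
      ≤ C ^ (m + 1) := by
  induction m with
  | zero =>
    have hunique := (volume_preserving_funUnique (Fin 1) ℝ).lintegral_comp_emb
      (MeasurableEquiv.measurableEmbedding _) g
    have hprod : ∀ l : Fin (0 + 1) → ℝ,
        (∏ k : Fin 0, f (l k.succ - l k.castSucc)) * ∏ j, g (l j)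
          = g (MeasurableEquiv.funUnique (Fin 1) ℝ l) := fun l => by simp
    simp_rw [hprod, zero_add, pow_one]
    refine le_of_eq_of_le ?_ hgC
    convert hunique
  | succ m ih =>
    rw [← (volume_preserving_piFinSuccAbove (fun _ : Fin (m + 2) => ℝ) 0).symm.lintegral_comp_emb
      (MeasurableEquiv.measurableEmbedding _)]
    have key : ∀ z : ℝ × (Fin (m + 1) → ℝ),
        (∏ k : Fin (m + 1), f ((MeasurableEquiv.piFinSuccAbove (fun _ => ℝ) 0).symm z k.succ
            - (MeasurableEquiv.piFinSuccAbove (fun _ => ℝ) 0).symm z k.castSucc))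
          * ∏ j, g ((MeasurableEquiv.piFinSuccAbove (fun _ => ℝ) 0).symm z j)
        = (f (z.2 0 - z.1) * g z.1)
          * ((∏ k : Fin m, f (z.2 k.succ - z.2 k.castSucc)) * ∏ j, g (z.2 j)) := by
      intro z
      simp only [MeasurableEquiv.piFinSuccAbove_symm_apply, Fin.insertNthEquiv_zero,
        Fin.consEquiv_apply, Fin.prod_univ_succ (n := m), Fin.prod_univ_succ (n := m + 1),
        Fin.cons_zero, Fin.cons_succ, Fin.castSucc_zero, ← Fin.succ_castSucc]
      ring
    simp_rw [key]
    rw [Measure.volume_eq_prod, lintegral_prod_symm' _ (by fun_prop)]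
    calc _ ≤ ∫⁻ l : Fin (m + 1) → ℝ,
          C * ((∏ k : Fin m, f (l k.succ - l k.castSucc)) * ∏ j, g (l j)) := by
          refine lintegral_mono fun l => ?_
          dsimp only
          rw [lintegral_mul_const _ (by fun_prop)]
          gcongr
          exact hfC _
      _ ≤ C * C ^ (m + 1) := by
          rw [lintegral_const_mul _ (by fun_prop)]
          gcongr
      _ = C ^ (m + 1 + 1) := (pow_succ' _ _).symm

theorem setLIntegral_Icc_abs_rpow_lt_top {s : ℝ} (hs : -1 < s) :
    ∫⁻ u in Set.Icc (-1 : ℝ) 1, ENNReal.ofReal (|u| ^ s) < ∞ := by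
  have h1 : IntervalIntegrable (fun u : ℝ => |u| ^ s) volume 0 1 := by
    refine (intervalIntegral.intervalIntegrable_rpow' hs).congr ?_
    intro u hu
    simp only [Set.uIoc_of_le zero_le_one] at hu
    simp [abs_of_pos hu.1]
  have h2 : IntervalIntegrable (fun u : ℝ => |u| ^ s) volume (-1) 0 := by
    simpa using (IntervalIntegrable.iff_comp_neg (by simp)).1 h1.symm
  have h3 := (intervalIntegrable_iff_integrableOn_Icc_of_le (by norm_num)).1 (h2.trans h1)
  exact h3.lintegral_lt_top

/-- A locally integrable power singularity against a Gaussian weight is bounded uniformly in the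
location of the singularity. -/
theorem exists_lintegral_abs_sub_rpow_mul_gaussian_le {s : ℝ} (hs : -1 < s) (hs0 : s ≤ 0) :
    ∃ C : ℝ≥0∞, C ≠ ∞ ∧ ∫⁻ x : ℝ, ENNReal.ofReal (exp (-x ^ 2 / 2)) ≤ C ∧
      ∀ y, ∫⁻ x : ℝ, ENNReal.ofReal (|y - x| ^ s) * ENNReal.ofReal (exp (-x ^ 2 / 2)) ≤ C := by
  have hgauss : Integrable fun x : ℝ => exp (-x ^ 2 / 2) := by
    refine (integrable_exp_neg_mul_sq (b := 1 / 2) (by norm_num)).congr (.of_forall fun x => ?_)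
    dsimp only
    ring_nf
  refine ⟨(∫⁻ u in Set.Icc (-1 : ℝ) 1, ENNReal.ofReal (|u| ^ s))
    + ∫⁻ x : ℝ, ENNReal.ofReal (exp (-x ^ 2 / 2)),
    ENNReal.add_ne_top.2 ⟨(setLIntegral_Icc_abs_rpow_lt_top hs).ne,
      hgauss.lintegral_lt_top.ne⟩, le_add_self, fun y => ?_⟩
  have hshift := lintegral_sub_left_eq_self (μ := (volume : Measure ℝ))
    ((Set.Icc (-1 : ℝ) 1).indicator fun u => ENNReal.ofReal (|u| ^ s)) y
  rw [← lintegral_indicator measurableSet_Icc, ← hshift, ← lintegral_add_right _ (by fun_prop)]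
  refine lintegral_mono fun x => ?_
  by_cases hx : y - x ∈ Set.Icc (-1 : ℝ) 1
  · simp only [Set.indicator_of_mem hx]
    refine le_add_right (mul_le_of_le_one_right' ?_)
    rw [ENNReal.ofReal_le_one, exp_le_one_iff]
    nlinarith [sq_nonneg x]
  · refine le_add_left (mul_le_of_le_one_left' ?_)
    rw [ENNReal.ofReal_le_one]
    refine rpow_le_one_of_one_le_of_nonpos ?_ hs0
    rw [Set.mem_Icc, ← abs_le] at hx
    exact (not_le.1 hx).le

theorem continuous_det_vandermonde (n : ℕ) :
    Continuous fun l : Fin n → ℝ => (Matrix.vandermonde l).det := by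
  simp only [Matrix.det_vandermonde]
  fun_prop

theorem measurable_abs_det_vandermonde_rpow (n : ℕ) (β : ℝ) :
    Measurable fun l : Fin n → ℝ => |(Matrix.vandermonde l).det| ^ β :=
  (continuous_det_vandermonde n).measurable.abs.pow_const β

theorem ofReal_exp_neg_sum_sq_div_two {n : ℕ} (l : Fin n → ℝ) :
    ENNReal.ofReal (exp (-(∑ j, l j ^ 2) / 2))
      = ∏ j, ENNReal.ofReal (exp (-l j ^ 2 / 2)) := by
  rw [← ENNReal.ofReal_prod_of_nonneg fun _ _ => (exp_pos _).le, ← exp_sum, ← Finset.sum_div,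
    Finset.sum_neg_distrib]

theorem integrable_abs_det_vandermonde_rpow_mul_gaussian_of_neg {m : ℕ} {β : ℝ} (hβ0 : β < 0)
    (hβ : -1 < (m + 1) * β / 2) :
    Integrable fun l : Fin (m + 1) → ℝ =>
      |(Matrix.vandermonde l).det| ^ β * exp (-(∑ j, l j ^ 2) / 2) := by
  set s : ℝ := (m + 1) * β / 2 with hs
  have hs0 : s ≤ 0 := by
    have : (m + 1 : ℝ) * β ≤ 0 := mul_nonpos_of_nonneg_of_nonpos (by positivity) hβ0.le
    linarith
  obtain ⟨C, hC, hgC, hfC⟩ := exists_lintegral_abs_sub_rpow_mul_gaussian_le hβ hs0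
  refine ⟨((measurable_abs_det_vandermonde_rpow _ β).mul (by fun_prop)).aestronglyMeasurable, ?_⟩
  rw [hasFiniteIntegral_iff_ofReal (.of_forall fun l => by positivity)]
  set f : ℝ → ℝ≥0∞ := fun u => ENNReal.ofReal (|u| ^ s) with hf_def
  set g : ℝ → ℝ≥0∞ := fun x => ENNReal.ofReal (exp (-x ^ 2 / 2)) with hg_def
  have hf : Measurable f := (measurable_id.abs.pow_const s).ennreal_ofReal
  have hg : Measurable g := by fun_prop
  have hperm : ∀ σ : Equiv.Perm (Fin (m + 1)),
      ∫⁻ l : Fin (m + 1) → ℝ, (∏ k : Fin m, f (l (σ k.succ) - l (σ k.castSucc))) * ∏ j, g (l j)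
        ≤ C ^ (m + 1) := by
    intro σ
    rw [← (volume_measurePreserving_piCongrLeft (fun _ : Fin (m + 1) => ℝ) σ).lintegral_comp_emb
      (MeasurableEquiv.measurableEmbedding _)]
    refine le_of_eq_of_le (lintegral_congr fun x => ?_) (lintegral_chain_le hf hg hgC hfC m)
    rw [← Equiv.prod_comp σ]
    simp only [MeasurableEquiv.coe_piCongrLeft, Equiv.piCongrLeft_apply_apply]
  calc _ ≤ ∫⁻ l : Fin (m + 1) → ℝ, ∑ σ : Equiv.Perm (Fin (m + 1)),
          (∏ k : Fin m, f (l (σ k.succ) - l (σ k.castSucc))) * ∏ j, g (l j) := by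
        refine lintegral_mono fun l => ?_
        dsimp only
        rw [ENNReal.ofReal_mul (by positivity), ofReal_exp_neg_sum_sq_div_two, ← Finset.sum_mul]
        gcongr
        refine (ENNReal.ofReal_le_ofReal (abs_det_vandermonde_rpow_le_sum_perm hβ0 l)).trans_eq ?_
        rw [ENNReal.ofReal_sum_of_nonneg fun σ _ => by positivity]
        refine Finset.sum_congr rfl fun σ _ => ?_
        rw [ENNReal.ofReal_prod_of_nonneg fun k _ => by positivity]
    _ = ∑ σ : Equiv.Perm (Fin (m + 1)), ∫⁻ l : Fin (m + 1) → ℝ,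
          (∏ k : Fin m, f (l (σ k.succ) - l (σ k.castSucc))) * ∏ j, g (l j) :=
        lintegral_finsetSum _ fun σ _ => by fun_prop
    _ ≤ ∑ _σ : Equiv.Perm (Fin (m + 1)), C ^ (m + 1) := Finset.sum_le_sum fun σ _ => hperm σ
    _ < ∞ := by
        rw [Finset.sum_const, nsmul_eq_mul]
        exact ENNReal.mul_lt_top (ENNReal.natCast_lt_top _) (ENNReal.pow_lt_top hC.lt_top)

theorem abs_det_vandermonde_le_exp {n : ℕ} (l : Fin n → ℝ) :
    |(Matrix.vandermonde l).det|
      ≤ exp ((∑ i : Fin n, (Finset.Ioi i).card : ℕ) * ∑ j, |l j|) := by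
  have hfac : ∀ i j : Fin n, i < j → |l j - l i| ≤ exp (∑ k, |l k|) := fun i j hij => by
    have h := Finset.sum_le_univ_sum_of_nonneg (s := {j, i}) (f := fun k => |l k|)
      fun k => abs_nonneg _
    rw [Finset.sum_pair hij.ne'] at h
    calc |l j - l i| ≤ |l j| + |l i| := abs_sub _ _
      _ ≤ ∑ k, |l k| := h
      _ ≤ exp (∑ k, |l k|) := by linarith [add_one_le_exp (∑ k, |l k|)]
  rw [Matrix.det_vandermonde, Finset.abs_prod, exp_nat_mul, ← Finset.prod_pow_eq_pow_sum]
  refine Finset.prod_le_prod (fun _ _ => abs_nonneg _) fun i _ => ?_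
  rw [Finset.abs_prod, ← Finset.prod_const]
  exact Finset.prod_le_prod (fun _ _ => abs_nonneg _) fun j hj => hfac i j (Finset.mem_Ioi.1 hj)

theorem integrable_abs_det_vandermonde_rpow_mul_gaussian_of_nonneg {n : ℕ} {β : ℝ} (hβ : 0 ≤ β) :
    Integrable fun l : Fin n → ℝ =>
      |(Matrix.vandermonde l).det| ^ β * exp (-(∑ j, l j ^ 2) / 2) := by
  set c : ℝ := (∑ i : Fin n, (Finset.Ioi i).card : ℕ) * β with hc
  have hdom : Integrable fun l : Fin n → ℝ => ∏ j, (exp (c ^ 2) * exp (-(1 / 4) * l j ^ 2)) :=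
    Integrable.fintype_prod (f := fun _ x => exp (c ^ 2) * exp (-(1 / 4) * x ^ 2))
      fun _ => (integrable_exp_neg_mul_sq (by norm_num)).const_mul _
  refine hdom.mono'
    ((measurable_abs_det_vandermonde_rpow _ β).mul (by fun_prop)).aestronglyMeasurable
    (.of_forall fun l => ?_)
  rw [norm_of_nonneg (by positivity)]
  calc _ ≤ exp ((∑ i : Fin n, (Finset.Ioi i).card : ℕ) * ∑ j, |l j|) ^ β
          * exp (-(∑ j, l j ^ 2) / 2) := by
        gcongr
        exact abs_det_vandermonde_le_exp l
    _ = exp (∑ j, (c * |l j| - l j ^ 2 / 2)) := by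
        rw [← exp_mul, ← exp_add, Finset.sum_sub_distrib, ← Finset.mul_sum, ← Finset.sum_div, hc]
        ring_nf
    _ = ∏ j, exp (c * |l j| - l j ^ 2 / 2) := exp_sum _ _
    _ ≤ _ := by
        refine Finset.prod_le_prod (fun _ _ => (exp_pos _).le) fun j _ => ?_
        rw [← exp_add, exp_le_exp]
        nlinarith [sq_nonneg (c - |l j| / 2), sq_abs (l j)]

theorem integrable_abs_det_vandermonde_rpow_mul_gaussian {n : ℕ} (hn : 2 ≤ n) {β : ℝ}
    (hβ : -2 / n < β) :
    Integrable fun l : Fin n → ℝ =>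
      |(Matrix.vandermonde l).det| ^ β * exp (-(∑ j, l j ^ 2) / 2) := by
  rcases le_or_gt 0 β with h0 | h0
  · exact integrable_abs_det_vandermonde_rpow_mul_gaussian_of_nonneg h0
  obtain ⟨m, rfl⟩ : ∃ m, n = m + 1 := ⟨n - 1, by omega⟩
  refine integrable_abs_det_vandermonde_rpow_mul_gaussian_of_neg h0 ?_
  rw [div_lt_iff₀ (by positivity)] at hβ
  push_cast at hβ
  linarith

theorem integral_abs_det_vandermonde_rpow_mul_gaussian_pos {n : ℕ} (hn : 2 ≤ n) {β : ℝ}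
    (hβ : -2 / n < β) :
    0 < ∫ l : Fin n → ℝ, |(Matrix.vandermonde l).det| ^ β * exp (-(∑ j, l j ^ 2) / 2) := by
  rw [integral_pos_iff_support_of_nonneg (fun l => by positivity)
    (integrable_abs_det_vandermonde_rpow_mul_gaussian hn hβ)]
  have hopen : IsOpen {l : Fin n → ℝ | (Matrix.vandermonde l).det ≠ 0} :=
    isOpen_ne.preimage (continuous_det_vandermonde n)
  have hne : {l : Fin n → ℝ | (Matrix.vandermonde l).det ≠ 0}.Nonempty :=
    ⟨fun j => (j : ℕ), Matrix.det_vandermonde_ne_zero_iff.2 fun i j h => by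
      simpa [Fin.ext_iff] using h⟩
  refine (hopen.measure_pos volume hne).trans_le (measure_mono fun l hl => ?_)
  have : 0 < |(Matrix.vandermonde l).det| := abs_pos.2 hl
  exact ne_of_gt (by positivity)

/-- The sublevel sets of half the squared norm have homogeneous mass under a homogeneous density. -/
theorem setLIntegral_sum_sq_div_two_le_of_homogeneous {n : ℕ} {h : (Fin n → ℝ) → ℝ} {a : ℝ}
    (hm : Measurable h) (hom : ∀ c : ℝ, 0 < c → ∀ l, h (c • l) = c ^ a * h l) {r : ℝ}
    (hr : 0 < r) :
    ∫⁻ l in {l : Fin n → ℝ | (∑ j, l j ^ 2) / 2 ≤ r}, ENNReal.ofReal (h l)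
      = ENNReal.ofReal (r ^ ((n + a) / 2))
        * ∫⁻ l in {l : Fin n → ℝ | (∑ j, l j ^ 2) / 2 ≤ 1}, ENNReal.ofReal (h l) := by
  have hS : ∀ t : ℝ, MeasurableSet {l : Fin n → ℝ | (∑ j, l j ^ 2) / 2 ≤ t} := fun t =>
    measurableSet_le (by fun_prop) measurable_const
  have hR : 0 < √r := sqrt_pos.2 hr
  have hscale := Measure.map_addHaar_smul (volume : Measure (Fin n → ℝ)) hR.ne'
  rw [Module.finrank_fin_fun, abs_of_pos (by positivity)] at hscale
  have hmap : ∫⁻ l in {l : Fin n → ℝ | (∑ j, l j ^ 2) / 2 ≤ 1}, ENNReal.ofReal (h (√r • l))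
      = ENNReal.ofReal ((√r ^ n)⁻¹)
        * ∫⁻ l in {l : Fin n → ℝ | (∑ j, l j ^ 2) / 2 ≤ r}, ENNReal.ofReal (h l) := by
    rw [← smul_eq_mul, ← lintegral_smul_measure, ← Measure.restrict_smul, ← hscale,
      setLIntegral_map (hS r) hm.ennreal_ofReal (by fun_prop)]
    congr 2
    ext l
    simp only [Set.mem_ofPred_eq, Set.mem_preimage, Pi.smul_apply, smul_eq_mul, mul_pow,
      sq_sqrt hr.le, ← Finset.mul_sum]
    rw [mul_div_assoc, mul_le_iff_le_one_right hr]
  simp_rw [hom _ hR, ENNReal.ofReal_mul (rpow_nonneg hR.le a)] at hmap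
  rw [lintegral_const_mul _ hm.ennreal_ofReal] at hmap
  have hpow : r ^ ((n + a) / 2) = √r ^ n * √r ^ a := by
    rw [← rpow_natCast, ← rpow_add hR, sqrt_eq_rpow, ← rpow_mul hr.le]
    ring_nf
  rw [hpow, ENNReal.ofReal_mul (by positivity), mul_assoc, hmap, ← mul_assoc,
    ← ENNReal.ofReal_mul (by positivity), mul_inv_cancel₀ (by positivity), ENNReal.ofReal_one,
    one_mul]

theorem measure_ext_of_Iic_of_ne_top {μ ν : Measure ℝ} (hfin : ∀ r, μ (Set.Iic r) ≠ ∞)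
    (h : ∀ r, μ (Set.Iic r) = ν (Set.Iic r)) : μ = ν := by
  refine μ.ext_of_Ioc' ν (fun a b _ => measure_ne_top_of_subset Set.Ioc_subset_Iic_self (hfin b))
    fun a b hab => ?_
  rw [← Set.Iic_sdiff_Iic, measure_sdiff (Set.Iic_subset_Iic.2 hab.le)
      measurableSet_Iic.nullMeasurableSet (hfin a),
    measure_sdiff (Set.Iic_subset_Iic.2 hab.le) measurableSet_Iic.nullMeasurableSet
      (h a ▸ hfin a), h a, h b]

theorem setLIntegral_Iic_indicator_rpow {α : ℝ} (hα : 0 < α) (r : ℝ) :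
    ∫⁻ x in Set.Iic r, (Set.Ici (0 : ℝ)).indicator (fun x => ENNReal.ofReal (x ^ (α - 1))) x
      = ENNReal.ofReal (max r 0 ^ α / α) := by
  rw [setLIntegral_indicator measurableSet_Ici, Set.inter_comm, Set.Iic_inter_Ici]
  rcases lt_or_ge r 0 with hr | hr
  · simp [Set.Icc_eq_empty hr.not_ge, max_eq_right hr.le, zero_rpow hα.ne']
  have hint : IntegrableOn (fun x : ℝ => x ^ (α - 1)) (Set.Icc 0 r) :=
    (intervalIntegrable_iff_integrableOn_Icc_of_le hr).1
      (intervalIntegral.intervalIntegrable_rpow' (by linarith))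
  rw [← ofReal_integral_eq_lintegral_ofReal hint
    ((ae_restrict_iff' measurableSet_Icc).2 (.of_forall fun x hx => rpow_nonneg hx.1 _)),
    integral_Icc_eq_integral_Ioc, ← intervalIntegral.integral_of_le hr,
    integral_rpow (.inl (by linarith)), sub_add_cancel, zero_rpow hα.ne', sub_zero, max_eq_left hr]

theorem gammaMeasure_one_eq_smul_withDensity {α : ℝ} (hα : 0 < α) :
    ENNReal.ofReal (Gamma α) • gammaMeasure α 1
      = (volume.withDensity ((Set.Ici (0 : ℝ)).indicator
          fun x => ENNReal.ofReal (x ^ (α - 1)))).withDensity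
          fun x => ENNReal.ofReal (exp (-x)) := by
  rw [gammaMeasure, ← withDensity_mul _ (by measurability) (by fun_prop),
    ← withDensity_smul _ (by exact (measurable_gammaPDFReal α 1).ennreal_ofReal)]
  congr 1
  ext x
  have hΓ := Gamma_pos_of_pos hα
  by_cases hx : 0 ≤ x
  · rw [Pi.smul_apply, Pi.mul_apply, Set.indicator_of_mem (Set.mem_Ici.2 hx),
      gammaPDF_of_nonneg hx, smul_eq_mul, ← ENNReal.ofReal_mul hΓ.le,
      ← ENNReal.ofReal_mul (by positivity), one_rpow, one_mul]
    congr 1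
    field_simp
  · rw [Pi.smul_apply, Pi.mul_apply, Set.indicator_of_notMem (by simpa using hx),
      gammaPDF_of_neg (not_le.1 hx), smul_zero, zero_mul]

theorem map_withDensity_comp {X Y : Type*} [MeasurableSpace X] [MeasurableSpace Y]
    {μ : Measure X} {q : X → Y} (hq : Measurable q) {w : Y → ℝ≥0∞} (hw : Measurable w) :
    (μ.withDensity fun x => w (q x)).map q = (μ.map q).withDensity w := by
  ext s hs
  rw [Measure.map_apply hq hs, withDensity_apply _ (hq hs), withDensity_apply _ hs,
    setLIntegral_map hs hw hq]

/-- The image of a homogeneous density under half the squared norm is a power density. -/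
theorem map_sum_sq_div_two_of_homogeneous {n : ℕ} (hn : n ≠ 0) {h : (Fin n → ℝ) → ℝ} {a : ℝ}
    (hm : Measurable h) (hom : ∀ c : ℝ, 0 < c → ∀ l, h (c • l) = c ^ a * h l)
    (ha : 0 < (n + a) / 2)
    (hfin : ∫⁻ l in {l : Fin n → ℝ | (∑ j, l j ^ 2) / 2 ≤ 1}, ENNReal.ofReal (h l) ≠ ∞) :
    ∃ K : ℝ≥0∞, (volume.withDensity fun l => ENNReal.ofReal (h l)).map
        (fun l => (∑ j, l j ^ 2) / 2)
      = K • volume.withDensity ((Set.Ici (0 : ℝ)).indicator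
          fun x => ENNReal.ofReal (x ^ ((n + a) / 2 - 1))) := by
  set α : ℝ := (n + a) / 2 with hα
  set A := ∫⁻ l in {l : Fin n → ℝ | (∑ j, l j ^ 2) / 2 ≤ 1}, ENNReal.ofReal (h l) with hA
  have hS : ∀ t : ℝ, MeasurableSet {l : Fin n → ℝ | (∑ j, l j ^ 2) / 2 ≤ t} := fun t =>
    measurableSet_le (by fun_prop) measurable_const
  have hIic : ∀ r, (volume.withDensity fun l => ENNReal.ofReal (h l)).map
      (fun l : Fin n → ℝ => (∑ j, l j ^ 2) / 2) (Set.Iic r)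
        = ENNReal.ofReal (max r 0 ^ α) * A := by
    intro r
    rw [Measure.map_apply (by fun_prop) measurableSet_Iic]
    change (volume.withDensity fun l => ENNReal.ofReal (h l))
      {l : Fin n → ℝ | (∑ j, l j ^ 2) / 2 ≤ r} = _
    rw [withDensity_apply _ (hS r)]
    rcases lt_or_ge 0 r with hr | hr
    · rw [setLIntegral_sum_sq_div_two_le_of_homogeneous hm hom hr, max_eq_left hr.le]
    · rw [max_eq_right hr, zero_rpow ha.ne', ENNReal.ofReal_zero, zero_mul]
      have : Nonempty (Fin n) := ⟨⟨0, Nat.pos_of_ne_zero hn⟩⟩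
      refine setLIntegral_measure_zero _ _ (measure_mono_null (t := {0}) (fun l hl => ?_)
        (measure_singleton _))
      have hsum : ∑ j, l j ^ 2 = 0 :=
        le_antisymm (by have : (∑ j, l j ^ 2) / 2 ≤ r := hl; linarith)
          (Finset.sum_nonneg fun j _ => sq_nonneg _)
      rw [Finset.sum_eq_zero_iff_of_nonneg fun j _ => sq_nonneg _] at hsum
      ext j
      simpa using hsum j (Finset.mem_univ j)
  refine ⟨ENNReal.ofReal α * A, measure_ext_of_Iic_of_ne_top (fun r => ?_) fun r => ?_⟩
  · rw [hIic]
    exact ENNReal.mul_ne_top ENNReal.ofReal_ne_top hfin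
  · rw [hIic, Measure.smul_apply, withDensity_apply _ measurableSet_Iic,
      setLIntegral_Iic_indicator_rpow ha, smul_eq_mul, mul_right_comm,
      ← ENNReal.ofReal_mul ha.le, mul_div_cancel₀ _ ha.ne']

/-- Under a homogeneous density of degree `a` against the Gaussian weight on `ℝⁿ`, half the squared
norm is Gamma distributed with shape `(n + a) / 2`. -/
theorem map_sum_sq_div_two_eq_gammaMeasure {n : ℕ} (hn : n ≠ 0) {h : (Fin n → ℝ) → ℝ} {a : ℝ}
    (hm : Measurable h) (h0 : ∀ l, 0 ≤ h l)
    (hom : ∀ c : ℝ, 0 < c → ∀ l, h (c • l) = c ^ a * h l) (ha : 0 < (n + a) / 2)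
    (hint : Integrable fun l : Fin n → ℝ => h l * exp (-(∑ j, l j ^ 2) / 2))
    (hpos : 0 < ∫ l : Fin n → ℝ, h l * exp (-(∑ j, l j ^ 2) / 2)) :
    ((volume : Measure (Fin n → ℝ)).withDensity fun l => ENNReal.ofReal
        ((∫ l : Fin n → ℝ, h l * exp (-(∑ j, l j ^ 2) / 2))⁻¹
          * (h l * exp (-(∑ j, l j ^ 2) / 2)))).map (fun l => (∑ j, l j ^ 2) / 2)
      = gammaMeasure ((n + a) / 2) 1 := by
  set Z := ∫ l : Fin n → ℝ, h l * exp (-(∑ j, l j ^ 2) / 2) with hZ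
  have hq : Measurable fun l : Fin n → ℝ => (∑ j, l j ^ 2) / 2 := by fun_prop
  have hS : MeasurableSet {l : Fin n → ℝ | (∑ j, l j ^ 2) / 2 ≤ 1} :=
    measurableSet_le hq measurable_const
  have hnonneg : ∀ l : Fin n → ℝ, 0 ≤ h l * exp (-(∑ j, l j ^ 2) / 2) := fun l =>
    mul_nonneg (h0 l) (exp_pos _).le
  have hfin : ∫⁻ l in {l : Fin n → ℝ | (∑ j, l j ^ 2) / 2 ≤ 1}, ENNReal.ofReal (h l) ≠ ∞ := by
    refine ne_top_of_le_ne_top (hint.const_mul (exp 1)).lintegral_lt_top.ne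
      ((setLIntegral_mono' hS fun l hl => ENNReal.ofReal_le_ofReal ?_).trans
        (setLIntegral_le_lintegral _ _))
    have hl' : (∑ j, l j ^ 2) / 2 ≤ 1 := hl
    rw [mul_left_comm, ← exp_add]
    exact le_mul_of_one_le_right (h0 l) (one_le_exp (by linarith))
  obtain ⟨K, hK⟩ := map_sum_sq_div_two_of_homogeneous hn hm hom ha hfin
  have hprop : ((volume : Measure (Fin n → ℝ)).withDensity fun l => ENNReal.ofReal
      (Z⁻¹ * (h l * exp (-(∑ j, l j ^ 2) / 2)))).map (fun l => (∑ j, l j ^ 2) / 2)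
        = (ENNReal.ofReal Z⁻¹ * K * ENNReal.ofReal (Gamma ((n + a) / 2)))
          • gammaMeasure ((n + a) / 2) 1 := by
    have hdens : (fun l : Fin n → ℝ => ENNReal.ofReal
        (Z⁻¹ * (h l * exp (-(∑ j, l j ^ 2) / 2))))
          = ENNReal.ofReal Z⁻¹ • ((fun l => ENNReal.ofReal (h l))
            * fun l => ENNReal.ofReal (exp (-((∑ j, l j ^ 2) / 2)))) := by
      ext l
      simp only [Pi.smul_apply, Pi.mul_apply, smul_eq_mul]
      rw [ENNReal.ofReal_mul (inv_nonneg.2 hpos.le), ENNReal.ofReal_mul (h0 l), neg_div]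
    rw [hdens, withDensity_smul' _ _ ENNReal.ofReal_ne_top,
      withDensity_mul _ hm.ennreal_ofReal (by fun_prop), Measure.map_smul,
      map_withDensity_comp hq (w := fun x => ENNReal.ofReal (exp (-x))) (by fun_prop), hK,
      withDensity_smul_measure, ← gammaMeasure_one_eq_smul_withDensity ha, smul_smul, smul_smul,
      mul_assoc]
  have := isProbabilityMeasure_gammaMeasure ha one_pos
  have hmass := congrArg (fun ρ : Measure ℝ => ρ Set.univ) hprop
  simp only [Measure.smul_apply, measure_univ, smul_eq_mul, mul_one] at hmass
  rw [Measure.map_apply hq MeasurableSet.univ, Set.preimage_univ,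
    withDensity_apply _ MeasurableSet.univ, Measure.restrict_univ,
    ← ofReal_integral_eq_lintegral_ofReal (hint.const_mul _)
      (.of_forall fun l => mul_nonneg (inv_nonneg.2 hpos.le) (hnonneg l)),
    integral_const_mul, ← hZ, inv_mul_cancel₀ hpos.ne', ENNReal.ofReal_one] at hmass
  rw [hprop, ← hmass, one_smul]

/-- Under the GβE, `p₂(λ)/2` has the `Gamma(d(β,n)/2, 1)` distribution, where `d(β,n) = n + n(n-1)β/2`. -/
theorem gbe_p2_gamma (n : ℕ) (hn : 2 ≤ n) (β : ℝ) (hβ : -2 / n < β)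
    (Z : ℝ) (μ : Measure (Fin n → ℝ))
    (hZ : Z = ∫ l : Fin n → ℝ,
      |∏ p ∈ Finset.univ.filter (fun p : Fin n × Fin n => p.1 < p.2), (l p.2 - l p.1)| ^ β
        * Real.exp (-(∑ j, l j ^ 2) / 2))
    (hμ : μ = (volume : Measure (Fin n → ℝ)).withDensity fun l =>
      ENNReal.ofReal (Z⁻¹ *
        (|∏ p ∈ Finset.univ.filter (fun p : Fin n × Fin n => p.1 < p.2), (l p.2 - l p.1)| ^ β
          * Real.exp (-(∑ j, l j ^ 2) / 2)))) :
    Measure.map (fun l => (∑ j, l j ^ 2) / 2) μ = gammaMeasure ((n + n * (n - 1) * β / 2) / 2) 1 := by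
  simp_rw [prod_filter_lt_eq_det_vandermonde] at hZ hμ
  subst hZ hμ
  have hn0 : (0 : ℝ) < n := by positivity
  have hβ' : -2 < β * n := (div_lt_iff₀ hn0).1 hβ
  have hn1 : (2 : ℝ) ≤ n := by exact_mod_cast hn
  refine map_sum_sq_div_two_eq_gammaMeasure (by omega) (measurable_abs_det_vandermonde_rpow n β)
    (fun l => by positivity) (fun c hc l => abs_det_vandermonde_rpow_smul β hc l) ?_
    (integrable_abs_det_vandermonde_rpow_mul_gaussian hn hβ)
    (integral_abs_det_vandermonde_rpow_mul_gaussian_pos hn hβ)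
  nlinarith [mul_nonneg (sub_nonneg.2 hn1) (by linarith : 0 ≤ β * n + 2)]
end
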